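/- arXiv:1604.04974 — 12 statements merged into one kernel-verified Lean document; each statement's English description precedes it below -/
import Mathlib

section
/- Let G be a finite group. Then the number of cyclic subgroups of G equals |G| - 2 if and only if G is isomorphic to one of the following groups: the cyclic group Z/6Z, the direct product Z/2Z × Z/4Z, the dihedral group D12 of order 12, or the direct product Z/2Z × D8 where D8 is the dihedral group of order 8. -/
/-- The elements of `G` that are not of order at most two are `a`, `b` and their inverses, and `a`
and `b` generate different subgroups. -/
structure IsExceptionalPair {G : Type*} [Group G] (a b : G) : Prop where
  left_ne : a * a ≠ 1
  right_ne : b * b ≠ 1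
  zpowers_ne : Subgroup.zpowers a ≠ Subgroup.zpowers b
  cover : ∀ g : G, g * g = 1 ∨ g = a ∨ g = a⁻¹ ∨ g = b ∨ g = b⁻¹

section Counting

variable {G : Type*} [Group G]

theorem eq_of_zpowers_eq_of_mul_self_eq_one {g h : G} (hg : g * g = 1)
    (e : Subgroup.zpowers g = Subgroup.zpowers h) : g = h := by
  have key : ∀ x ∈ Subgroup.zpowers g, x = 1 ∨ x = g := by
    rintro x ⟨k, rfl⟩
    have hg' : g ^ 2 = 1 := by rw [sq, hg]
    rcases Int.even_or_odd' k with ⟨m, rfl | rfl⟩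
    · left; simp [zpow_mul, hg']
    · right; simp [zpow_add, zpow_mul, hg']
  rcases key h (e ▸ Subgroup.mem_zpowers h) with rfl | rfl
  · simpa using e
  · rfl

theorem exists_isExceptionalPair_of_card [Finite G]
    (h : Nat.card {H : Subgroup G // IsCyclic H} = Nat.card G - 2) :
    ∃ a b : G, IsExceptionalPair a b := by
  let q : G → {H : Subgroup G // IsCyclic H} := fun g => ⟨Subgroup.zpowers g, inferInstance⟩
  have hq : Function.Surjective q := by
    rintro ⟨H, hH⟩
    obtain ⟨g, hg⟩ := (Subgroup.isCyclic_iff_exists_zpowers_eq_top H).1 hH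
    exact ⟨g, Subtype.ext hg⟩
  have hq_iff : ∀ x y, q x = q y ↔ Subgroup.zpowers x = Subgroup.zpowers y := fun x y =>
    Subtype.ext_iff
  have hq_inv : ∀ x, q x⁻¹ = q x := fun x => Subtype.ext (Subgroup.zpowers_inv)
  have hq_invol : ∀ x y, x * x = 1 → q x = q y → x = y := fun x y hx e =>
    eq_of_zpowers_eq_of_mul_self_eq_one hx ((hq_iff x y).1 e)
  obtain ⟨s, hs⟩ := hq.hasRightInverse
  have hcard : (Set.range s)ᶜ.ncard = 2 := by
    have h1 := Set.ncard_add_ncard_compl (Set.range s)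
    rw [← Set.image_univ, Set.ncard_image_of_injective _ hs.injective, Set.ncard_univ, h,
      Set.image_univ] at h1
    have h2 : 0 < Nat.card {H : Subgroup G // IsCyclic H} :=
      Nat.card_pos_iff.2 ⟨⟨q 1⟩, inferInstance⟩
    omega
  obtain ⟨u, v, huv, hD⟩ := Set.ncard_eq_two.1 hcard
  have mem : ∀ x, s (q x) = x ∨ x = u ∨ x = v := by
    intro x
    by_cases hx : x ∈ Set.range s
    · obtain ⟨y, rfl⟩ := hx
      exact Or.inl (by rw [hs y])
    · have : x ∈ (Set.range s)ᶜ := hx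
      rw [hD] at this
      exact Or.inr this
  have hu : s (q u) ≠ u := fun e => by
    have : u ∈ (Set.range s)ᶜ := hD ▸ Set.mem_insert _ _
    exact this ⟨_, e⟩
  have hv : s (q v) ≠ v := fun e => by
    have : v ∈ (Set.range s)ᶜ := hD ▸ Set.mem_insert_of_mem _ rfl
    exact this ⟨_, e⟩
  have hu2 : u * u ≠ 1 := fun e => hu (hq_invol _ _ e (hs _).symm).symm
  have hv2 : v * v ≠ 1 := fun e => hv (hq_invol _ _ e (hs _).symm).symm
  refine ⟨u, v, hu2, hv2, fun e => ?_, fun g => ?_⟩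
  · have e' := (hq_iff u v).2 e
    have hu' := mem u⁻¹
    have hv' := mem v⁻¹
    have hw := mem (s (q u))⁻¹
    have hw2 : s (q u) * s (q u) ≠ 1 := fun h2 => hu (hq_invol _ _ h2 (hs _))
    have ne_inv : ∀ {x : G}, x * x ≠ 1 → x⁻¹ ≠ x := fun hx h1 => hx (by
      nth_rewrite 1 [← h1]; simp)
    have hun := ne_inv hu2
    have hvn := ne_inv hv2
    have hwn := ne_inv hw2
    simp only [hq_inv, ← e', hs (q u)] at hu' hv' hw
    rw [← e'] at hv
    have e1 : ∀ x y : G, x⁻¹ = y ↔ y⁻¹ = x := fun x y => by rw [inv_eq_iff_eq_inv, eq_comm]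
    grind
  · by_cases hg : g * g = 1
    · exact Or.inl hg
    · right
      rcases mem g with h1 | h1 | h1
      · rcases mem g⁻¹ with h2 | h2 | h2
        · rw [hq_inv, h1] at h2
          exact absurd (by nth_rewrite 1 [h2]; simp) hg
        · exact Or.inr (Or.inl (by rw [← h2, inv_inv]))
        · exact Or.inr (Or.inr (Or.inr (by rw [← h2, inv_inv])))
      · exact Or.inl h1
      · exact Or.inr (Or.inr (Or.inl h1))

theorem IsExceptionalPair.card_cyclic_subgroups [Finite G] {a b : G} (H : IsExceptionalPair a b) :
    Nat.card {H : Subgroup G // IsCyclic H} = Nat.card G - 2 := by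
  obtain ⟨ha, hb, hab, h⟩ := H
  have hne : a⁻¹ ≠ b⁻¹ := fun e => hab (by rw [inv_injective e])
  have hcard : ({a⁻¹, b⁻¹} : Set G)ᶜ.ncard = Nat.card G - 2 := by
    rw [Set.ncard_compl, Set.ncard_pair hne]
  have ha' : a⁻¹ ≠ a := fun e => ha (by nth_rewrite 1 [← e]; simp)
  have hb' : b⁻¹ ≠ b := fun e => hb (by nth_rewrite 1 [← e]; simp)
  have hab1 : a ≠ b⁻¹ := fun e => hab (by rw [e, Subgroup.zpowers_inv])
  have hab2 : b ≠ a⁻¹ := fun e => hab (by rw [e, Subgroup.zpowers_inv])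
  rw [← hcard, ← Nat.card_coe_set_eq]
  symm
  refine Nat.card_eq_of_bijective
    (fun g => (⟨Subgroup.zpowers g.1, inferInstance⟩ : {H : Subgroup G // IsCyclic H})) ⟨?_, ?_⟩
  · rintro ⟨x, hx⟩ ⟨y, hy⟩ e
    have e : Subgroup.zpowers x = Subgroup.zpowers y := congrArg Subtype.val e
    simp only [Set.mem_compl_iff, Set.mem_insert_iff, Set.mem_singleton_iff, not_or] at hx hy
    refine Subtype.ext ?_
    change x = y
    have hx' := h x
    have hy' := h y
    by_cases hx2 : x * x = 1
    · exact eq_of_zpowers_eq_of_mul_self_eq_one hx2 e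
    by_cases hy2 : y * y = 1
    · exact (eq_of_zpowers_eq_of_mul_self_eq_one hy2 e.symm).symm
    grind
  · rintro ⟨H, hH⟩
    obtain ⟨g, hg⟩ := (Subgroup.isCyclic_iff_exists_zpowers_eq_top H).1 hH
    subst hg
    by_cases hg : g = a⁻¹ ∨ g = b⁻¹
    · rcases hg with rfl | rfl
      · exact ⟨⟨a, by simp [hab1, ha'.symm]⟩, by simp⟩
      · exact ⟨⟨b, by simp [hab2, hb'.symm]⟩, by simp⟩
    · exact ⟨⟨g, by simpa using hg⟩, rfl⟩

end Counting

theorem zpowers_ne_of_forall_pow_ne {G : Type*} [Group G] {a b : G} {n : ℕ} (hn : b ^ n = 1)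
    (hn0 : n ≠ 0) (h : ∀ k < n, b ^ k ≠ a) : Subgroup.zpowers a ≠ Subgroup.zpowers b := by
  intro e
  have ha : a ∈ Subgroup.zpowers b := e ▸ Subgroup.mem_zpowers a
  obtain ⟨k, rfl⟩ :=
    (isOfFinOrder_iff_pow_eq_one.2 ⟨n, by omega, hn⟩).mem_powers_iff_mem_zpowers.2 ha
  exact h (k % n) (Nat.mod_lt _ (by omega)) (pow_eq_pow_mod k hn).symm

theorem card_cyclic_subgroups_congr {G H : Type*} [Group G] [Group H] (e : G ≃* H) :
    Nat.card {K : Subgroup G // IsCyclic K} = Nat.card {K : Subgroup H // IsCyclic K} :=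
  Nat.card_congr <| e.mapSubgroup.toEquiv.subtypeEquiv fun K =>
    (e.subgroupMap K).isCyclic

section Embeddings

variable {G : Type*} [Group G]

theorem exists_zmod_hom {a : G} {n : ℕ} (ha : orderOf a = n) :
    ∃ f : Multiplicative (ZMod n) →* G, Function.Injective f ∧ f.range = Subgroup.zpowers a := by
  obtain ⟨e⟩ : Nonempty (Multiplicative (ZMod n) ≃* Subgroup.zpowers a) := ⟨
    zmodMulEquivOfGenerator (g := ⟨a, Subgroup.mem_zpowers a⟩)
      (by
        rintro ⟨_, k, rfl⟩
        exact ⟨k, Subtype.ext (by simp)⟩)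
      (by rw [Nat.card_zpowers, ha])⟩
  refine ⟨(Subgroup.zpowers a).subtype.comp e.toMonoidHom,
    (Subgroup.subtype_injective _).comp e.injective, ?_⟩
  rw [MonoidHom.range_comp, MonoidHom.range_eq_top (f := e.toMonoidHom) |>.2 e.surjective,
    ← MonoidHom.range_eq_map,
    Subgroup.range_subtype]

theorem exists_zmod_two_prod_hom {H : Type*} [Group H] {f : H →* G} (hf : Function.Injective f)
    {c : G} (hc : c * c = 1) (hcf : c ∉ f.range) (comm : ∀ h, Commute c (f h)) :
    ∃ F : Multiplicative (ZMod 2) × H →* G, Function.Injective F ∧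
      ∀ g, g ∈ F.range ↔ g ∈ f.range ∨ c * g ∈ f.range := by
  have hc1 : c ≠ 1 := fun e => hcf (e ▸ f.range.one_mem)
  obtain ⟨z, hz, hzr⟩ := exists_zmod_hom (orderOf_eq_prime (p := 2) (by rw [sq, hc]) hc1)
  have hzc : ∀ i, z i = 1 ∨ z i = c := by
    intro i
    obtain ⟨k, hk⟩ : z i ∈ Subgroup.zpowers c := hzr ▸ ⟨i, rfl⟩
    have hc' : c ^ 2 = 1 := by rw [sq, hc]
    rcases Int.even_or_odd' k with ⟨m, rfl | rfl⟩
    · left; simp [← hk, zpow_mul, hc']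
    · right; simp [← hk, zpow_add, zpow_mul, hc']
  obtain ⟨i₀, hi₀⟩ : c ∈ z.range := hzr ▸ Subgroup.mem_zpowers c
  refine ⟨z.noncommCoprod f fun i h => ?_, ?_, fun g => ⟨?_, ?_⟩⟩
  · rcases hzc i with e | e <;> rw [e]
    · exact Commute.one_left _
    · exact comm h
  · rw [injective_iff_map_eq_one]
    rintro ⟨i, h⟩ e
    rw [MonoidHom.noncommCoprod_apply] at e
    rcases hzc i with e' | e' <;> simp only [e'] at e
    · rw [one_mul] at e
      exact Prod.ext ((map_eq_one_iff z hz).1 e') ((map_eq_one_iff f hf).1 e)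
    · exact absurd ⟨h⁻¹, by rw [map_inv]; exact (eq_inv_of_mul_eq_one_left e).symm⟩ hcf
  · rintro ⟨⟨i, h⟩, rfl⟩
    rw [MonoidHom.noncommCoprod_apply]
    rcases hzc i with e' | e' <;> simp only [e']
    · left; simp
    · right; simp [← mul_assoc, hc]
  · rintro (⟨h, rfl⟩ | ⟨h, hh⟩)
    · exact ⟨(1, h), by simp⟩
    · exact ⟨(i₀, h), by simp [hi₀, hh, ← mul_assoc, hc]⟩

theorem exists_dihedral_hom {a x : G} {n : ℕ} (ha : orderOf a = n) (hx : x * x = 1)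
    (hxa : x * a * x = a⁻¹) (hxn : x ∉ Subgroup.zpowers a) :
    ∃ f : DihedralGroup n →* G, Function.Injective f ∧
      ∀ g, g ∈ f.range ↔ g ∈ Subgroup.zpowers a ∨ x * g ∈ Subgroup.zpowers a := by
  obtain ⟨z, hz, hzr⟩ := exists_zmod_hom ha
  have hx' : x⁻¹ = x := inv_eq_of_mul_eq_one_left hx
  have conj : ∀ i, x * z i * x = (z i)⁻¹ := by
    intro i
    obtain ⟨k, hk⟩ : z i ∈ Subgroup.zpowers a := hzr ▸ ⟨i, rfl⟩
    have h := conj_zpow (i := k) (a := x) (b := a)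
    rw [hx', hxa] at h
    rw [← hk]
    simpa using h.symm
  have conj' : ∀ i, z i * x = x * (z i)⁻¹ := by
    intro i
    rw [← conj, ← mul_assoc, ← mul_assoc, hx, one_mul]
  let F : DihedralGroup n → G
    | .r i => z (.ofAdd i)
    | .sr i => x * z (.ofAdd i)
  let f : DihedralGroup n →* G := MonoidHom.mk' F (by
    rintro (i | i) (j | j)
    · simp [F]
    · simp only [F, DihedralGroup.r_mul_sr, ofAdd_sub, map_div]
      rw [← mul_assoc, conj', mul_assoc, ← map_inv, ← map_mul, ← map_div, div_eq_inv_mul]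
    · simp [F, mul_assoc]
    · simp only [F, DihedralGroup.sr_mul_sr, ofAdd_sub, map_div]
      rw [← mul_assoc, mul_assoc x, conj', ← mul_assoc, hx, one_mul, ← map_inv, ← map_mul,
        ← map_div, div_eq_inv_mul])
  refine ⟨f, ?_, fun g => ⟨?_, ?_⟩⟩
  · rw [injective_iff_map_eq_one]
    rintro (i | i) e
    · have : z (.ofAdd i) = 1 := e
      have := (map_eq_one_iff z hz).1 this
      rw [ofAdd_eq_one] at this
      rw [this, DihedralGroup.r_zero]
    · have e : x * z (.ofAdd i) = 1 := e
      refine absurd ?_ hxn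
      rw [← hzr, eq_inv_of_mul_eq_one_left e]
      exact inv_mem ⟨_, rfl⟩
  · rw [← hzr]
    rintro ⟨i | i, rfl⟩
    · exact Or.inl ⟨_, rfl⟩
    · exact Or.inr ⟨.ofAdd i, by simp [f, F, ← mul_assoc, hx]⟩
  · rw [← hzr]
    rintro (⟨h, rfl⟩ | ⟨h, hh⟩)
    · exact ⟨.r h.toAdd, rfl⟩
    · exact ⟨.sr h.toAdd, by simp [f, F, hh, ← mul_assoc, hx]⟩

end Embeddings

theorem mul_self_mul_mul_self {G : Type*} [Group G] (g : G) : g * g * (g * g) = g ^ 4 := by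
  rw [← sq, ← sq, ← pow_mul]

namespace IsExceptionalPair

variable {G : Type*} [Group G] {a b : G}

theorem symm (h : IsExceptionalPair a b) : IsExceptionalPair b a :=
  ⟨h.right_ne, h.left_ne, h.zpowers_ne.symm, fun g => by have := h.cover g; tauto⟩

theorem inv_right (h : IsExceptionalPair a b) : IsExceptionalPair a b⁻¹ :=
  ⟨h.left_ne, by simpa [← mul_inv_rev] using h.right_ne, by simpa using h.zpowers_ne,
    fun g => by have := h.cover g; rw [inv_inv]; tauto⟩

theorem ne (h : IsExceptionalPair a b) : a ≠ b := fun e => h.zpowers_ne (by rw [e])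

theorem ne_inv (h : IsExceptionalPair a b) : a ≠ b⁻¹ := h.inv_right.ne

theorem cover_of_ne (h : IsExceptionalPair a b) {g : G} (hg : g * g ≠ 1) :
    g = a ∨ g = a⁻¹ ∨ g = b ∨ g = b⁻¹ :=
  (h.cover g).resolve_left hg

theorem pow_cases_of_pow_three_eq (h : IsExceptionalPair a b) (e : a ^ 3 = b) :
    a ^ 3 = 1 ∨ a ^ 4 = 1 ∨ a ^ 6 = 1 := by
  have h1 : a ≠ 1 := fun e => h.left_ne (by simp [e])
  rcases h.cover (a ^ 2) with h2 | h2 | h2 | h2 | h2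
  · right; left; rw [← h2]; group
  · exact absurd (by simpa [sq] using h2) h1
  · left; rw [pow_succ, h2]; group
  · exact absurd (by simpa [← e, pow_succ] using h2) h1
  · refine absurd (le_antisymm ?_ ?_) h.zpowers_ne <;> rw [Subgroup.zpowers_le]
    · have h5 : a ^ 5 = 1 := by
        rw [show 5 = 2 + 3 from rfl, pow_add, h2, e, inv_mul_cancel]
      refine ⟨2, ?_⟩
      change b ^ (2 : ℤ) = a
      rw [← e]
      calc (a ^ 3) ^ (2 : ℤ) = a ^ 5 * a := by group
        _ = a := by rw [h5, one_mul]
    · exact ⟨3, by simpa using by exact_mod_cast e⟩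

theorem pow_cases (h : IsExceptionalPair a b) : a ^ 3 = 1 ∨ a ^ 4 = 1 ∨ a ^ 6 = 1 := by
  have h1 : a ≠ 1 := fun e => h.left_ne (by simp [e])
  rcases h.cover (a ^ 3) with h2 | h2 | h2 | h2 | h2
  · right; right; rw [← h2]; group
  · exact absurd (by simpa [pow_succ] using h2) h.left_ne
  · right; left; rw [pow_succ, h2]; group
  · exact h.pow_cases_of_pow_three_eq h2
  · exact h.inv_right.pow_cases_of_pow_three_eq h2

/-- Elements outside a subgroup containing `a` and `b` are involutions inverting that subgroup. -/
theorem mul_mul_eq_inv (h : IsExceptionalPair a b) {A : Subgroup G} (ha : a ∈ A) (hb : b ∈ A)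
    {x y : G} (hx : x ∉ A) (hy : y ∈ A) : x * x = 1 ∧ x * y * x = y⁻¹ := by
  have key : ∀ {g}, g ∉ A → g * g = 1 := by
    intro g hg
    rcases h.cover g with h1 | rfl | rfl | rfl | rfl
    · exact h1
    all_goals simp_all
  refine ⟨key hx, eq_inv_of_mul_eq_one_left ?_⟩
  simpa [mul_assoc] using key (g := x * y) fun hxy => hx ((A.mul_mem_cancel_right hy).1 hxy)

theorem mem_or_mul_mem (h : IsExceptionalPair a b) {A : Subgroup G} (ha : a ∈ A) (hb : b ∈ A)
    {x : G} (hx : x ∉ A) (g : G) : g ∈ A ∨ x * g ∈ A := by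
  by_contra! hg
  obtain ⟨hx1, hx2⟩ := h.mul_mul_eq_inv ha hb hx ha
  obtain ⟨hg1, hg2⟩ := h.mul_mul_eq_inv ha hb hg.1 ha
  obtain ⟨hxg1, hxg2⟩ := h.mul_mul_eq_inv ha hb hg.2 ha
  have hgx : x * g = g * x := by
    have := inv_eq_of_mul_eq_one_left hxg1
    rwa [mul_inv_rev, inv_eq_of_mul_eq_one_left hx1, inv_eq_of_mul_eq_one_left hg1, eq_comm] at this
  have : x * g * a * (x * g) = a := by
    nth_rewrite 2 [hgx]
    rw [show x * g * a * (g * x) = x * (g * a * g) * x by simp only [mul_assoc], hg2,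
      (h.mul_mul_eq_inv ha hb hx (inv_mem ha)).2, inv_inv]
  rw [this] at hxg2
  exact h.left_ne (by nth_rewrite 1 [hxg2]; simp)

theorem mul_eq_mul_or (h : IsExceptionalPair a b) : b * a = a * b ∨ b * a = a⁻¹ * b := by
  have hconj : (b * a * b⁻¹) * (b * a * b⁻¹) ≠ 1 := fun e => h.left_ne (by
    have : b * (a * a) * b⁻¹ = 1 := by rw [← e]; group
    simpa using this)
  rcases h.cover_of_ne hconj with e | e | e | e
  · exact Or.inl (mul_inv_eq_iff_eq_mul.1 e)
  · exact Or.inr (mul_inv_eq_iff_eq_mul.1 e)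
  · exact absurd (by simpa [mul_inv_eq_iff_eq_mul] using e) h.ne
  · exact absurd (eq_inv_of_mul_eq_one_right (by simpa [mul_inv_eq_iff_eq_mul] using e)) h.ne_inv

theorem left_ne_one (h : IsExceptionalPair a b) : a ≠ 1 := fun e => h.left_ne (by simp [e])

theorem pow_three_ne_one (h : IsExceptionalPair a b) (hb : b ^ 3 = 1 ∨ b ^ 4 = 1) :
    a ^ 3 ≠ 1 := by
  intro ha
  have hne := h.ne
  have hne' := h.ne_inv
  have ha2 := h.left_ne
  have hb2 := h.right_ne
  have ha3 : a * a = a⁻¹ := eq_inv_of_mul_eq_one_left (by rw [← ha, pow_succ, sq])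
  have ha1 := h.left_ne_one
  have hb1 := h.symm.left_ne_one
  rcases h.mul_eq_mul_or with e | e
  · have hsq : a * b * (a * b) = a * a * (b * b) := by
      rw [mul_assoc, ← mul_assoc b, e]; simp only [mul_assoc]
    have hbb : b * b = a ∨ b * b = a⁻¹ := by
      rcases h.cover (a * b) with e1 | e1 | e1 | e1 | e1
      · left
        rwa [hsq, ha3, inv_mul_eq_one, eq_comm] at e1
      · exact absurd (mul_eq_left.1 e1) hb1
      · rw [← ha3] at e1
        exact absurd (mul_left_cancel e1).symm hne
      · exact absurd (mul_eq_right.1 e1) ha1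
      · right
        rw [eq_inv_iff_mul_eq_one, mul_assoc] at e1
        exact eq_inv_of_mul_eq_one_right e1
    rcases hb with hb | hb
    · have hb3 : b * b = b⁻¹ := eq_inv_of_mul_eq_one_left (by rw [← hb, pow_succ, sq])
      rw [hb3] at hbb
      rcases hbb with e1 | e1
      · exact hne' e1.symm
      · exact hne (inv_injective e1).symm
    · have hb4 : b * b * (b * b) = 1 := by rw [mul_self_mul_mul_self, hb]
      rcases hbb with e1 | e1 <;> rw [e1] at hb4
      · exact ha2 hb4
      · exact ha2 (by simpa [← mul_inv_rev] using hb4)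
  · have e' : b * a⁻¹ = a * b := by
      rw [mul_inv_eq_iff_eq_mul, mul_assoc, e, mul_inv_cancel_left]
    have hc : b * b * a = a * (b * b) := by
      rw [mul_assoc, e, ← mul_assoc, e', mul_assoc]
    rcases hb with hb | hb
    · have hb3 : b * b = b⁻¹ := eq_inv_of_mul_eq_one_left (by rw [← hb, pow_succ, sq])
      rw [hb3, inv_mul_eq_iff_eq_mul, ← mul_assoc, e, eq_mul_inv_iff_mul_eq] at hc
      have : a⁻¹ = a := by simpa using hc.symm
      exact ha2 (by nth_rewrite 1 [← this]; simp)
    · have hb4 : b * b * (b * b) = 1 := by rw [mul_self_mul_mul_self, hb]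
      have hg : b * b * a * (b * b * a) ≠ 1 := by
        nth_rewrite 1 [hc]
        rwa [mul_assoc, ← mul_assoc (b * b), hb4, one_mul]
      rcases h.cover_of_ne hg with e1 | e1 | e1 | e1
      · exact hb2 (mul_eq_right.1 e1)
      · rw [← ha3] at e1
        rw [mul_right_cancel e1] at hb4
        exact ha2 hb4
      · exact hne' (eq_inv_of_mul_eq_one_right (by simpa [mul_assoc] using e1))
      · have h3 : b⁻¹ = b * b * b := by
          rw [inv_eq_iff_mul_eq_one, ← hb4]; simp only [mul_assoc]
        rw [h3] at e1
        exact hne (mul_left_cancel e1)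

theorem mul_self_eq_and_commute (h : IsExceptionalPair a b) (ha : a ^ 4 = 1) (hb : b ^ 4 = 1) :
    a * a = b * b ∧ Commute a b := by
  have hne := h.ne
  have hne' := h.ne_inv
  have ha2 := h.left_ne
  have hb2 := h.right_ne
  have ha1 := h.left_ne_one
  have hb1 := h.symm.left_ne_one
  have ha4 : a * a * (a * a) = 1 := by rw [mul_self_mul_mul_self, ha]
  have hb4 : b * b * (b * b) = 1 := by rw [mul_self_mul_mul_self, hb]
  have ha3 : a⁻¹ = a * a * a := by
    rw [inv_eq_iff_mul_eq_one, ← ha4]; simp only [mul_assoc]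
  have hc : b * (a * a) = a * a * b := by
    rcases h.mul_eq_mul_or with e | e
    · rw [← mul_assoc, e, mul_assoc, e, mul_assoc]
    · have : a⁻¹ * a⁻¹ = a * a := by rw [← mul_inv_rev]; exact inv_eq_of_mul_eq_one_left ha4
      rw [← mul_assoc, e, mul_assoc, e, ← mul_assoc, this]
  have hab : a * a = b * b := by
    have hg : a * a * b * (a * a * b) ≠ 1 := by
      nth_rewrite 1 [← hc]
      rwa [mul_assoc, ← mul_assoc (a * a), ha4, one_mul]
    rcases h.cover_of_ne hg with e1 | e1 | e1 | e1
    · exact absurd (eq_inv_of_mul_eq_one_left (by simpa [mul_assoc] using e1)) hne'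
    · rw [ha3] at e1
      exact absurd (mul_left_cancel e1).symm hne
    · exact absurd (mul_eq_right.1 e1) ha2
    · rw [eq_inv_iff_mul_eq_one, mul_assoc] at e1
      rw [eq_inv_of_mul_eq_one_left e1, inv_eq_of_mul_eq_one_left hb4]
  refine ⟨hab, ?_⟩
  rcases h.mul_eq_mul_or with e | e
  · exact e.symm
  · have hg : a * b * (a * b) ≠ 1 := by
      rwa [mul_assoc, ← mul_assoc b, e, mul_assoc a⁻¹, mul_inv_cancel_left]
    rcases h.cover_of_ne hg with e1 | e1 | e1 | e1
    · exact absurd (mul_eq_left.1 e1) hb1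
    · rw [ha3, mul_assoc] at e1
      rw [mul_left_cancel e1] at hb2
      exact absurd ha4 hb2
    · exact absurd (mul_eq_right.1 e1) ha1
    · rw [eq_inv_iff_mul_eq_one, mul_assoc, ← hab] at e1
      refine absurd ?_ ha1
      rwa [mul_assoc, e1, mul_one] at ha4

theorem mulEquiv_of_pow_four (h : IsExceptionalPair a b) (ha : a ^ 4 = 1) (hb : b ^ 4 = 1) :
    Nonempty (G ≃* (Multiplicative (ZMod 2) × Multiplicative (ZMod 4))) ∨
      Nonempty (G ≃* (Multiplicative (ZMod 2) × DihedralGroup 4)) := by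
  obtain ⟨hab, hcomm⟩ := h.mul_self_eq_and_commute ha hb
  have ha4 : a * a * (a * a) = 1 := by rw [mul_self_mul_mul_self, ha]
  have horder : orderOf a = 4 :=
    orderOf_eq_prime_pow (p := 2) (n := 1) (by simpa [sq] using h.left_ne) (by simpa using ha)
  have hamem := Subgroup.mem_zpowers a
  have hb_not : b ∉ Subgroup.zpowers a := by
    intro hmem
    have hfin : IsOfFinOrder a := isOfFinOrder_iff_pow_eq_one.2 ⟨4, by norm_num, ha⟩
    obtain ⟨k, hk⟩ := hfin.mem_powers_iff_mem_zpowers.2 hmem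
    have hk : a ^ k = b := hk
    rw [pow_eq_pow_mod k ha] at hk
    have hlt : k % 4 < 4 := Nat.mod_lt _ (by norm_num)
    interval_cases k % 4
    · exact h.symm.left_ne_one (by simpa using hk.symm)
    · exact h.ne (by simpa using hk)
    · exact h.right_ne (by rw [← hk, sq, ha4])
    · refine h.ne_inv (eq_inv_of_mul_eq_one_right ?_)
      rw [← hk, ← ha, pow_succ a 3]
  set c := a * b with hc
  have hc2 : c * c = 1 := by
    rw [hc, mul_assoc, ← mul_assoc b, ← hcomm.eq, mul_assoc, ← mul_assoc, ← hab, ha4]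
  have hca : Commute c a := (Commute.refl a).mul_left hcomm.symm
  have hc_not : c ∉ Subgroup.zpowers a := fun hm =>
    hb_not ((Subgroup.mul_mem_cancel_left _ hamem).1 hm)
  have hcz : ∀ y ∈ Subgroup.zpowers a, Commute c y := by
    rintro _ ⟨k, rfl⟩
    exact hca.zpow_right k
  obtain ⟨z, hz, hzr⟩ := exists_zmod_hom horder
  obtain ⟨F, hF, hFr⟩ := exists_zmod_two_prod_hom hz hc2 (hzr ▸ hc_not)
    (fun i => hcz _ (hzr ▸ ⟨i, rfl⟩))
  rw [hzr] at hFr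
  have haA : a ∈ F.range := (hFr a).2 (Or.inl hamem)
  have hbA : b ∈ F.range := (hFr b).2 (Or.inr (by
    rw [hc, mul_assoc, ← hab]
    exact mul_mem hamem (mul_mem hamem hamem)))
  have hcA : c ∈ F.range := mul_mem haA hbA
  by_cases hA : F.range = ⊤
  · exact Or.inl ⟨(MulEquiv.ofBijective F ⟨hF, MonoidHom.range_eq_top.1 hA⟩).symm⟩
  · right
    obtain ⟨x, hx⟩ : ∃ x, x ∉ F.range := by
      by_contra! hall
      exact hA ((Subgroup.eq_top_iff' _).2 hall)
    obtain ⟨hx2, hxa⟩ := h.mul_mul_eq_inv haA hbA hx haA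
    have hxc := (h.mul_mul_eq_inv haA hbA hx hcA).2
    have hle : Subgroup.zpowers a ≤ F.range := by rwa [Subgroup.zpowers_le]
    obtain ⟨D, hD, hDr⟩ := exists_dihedral_hom horder hx2 hxa fun hm => hx (hle hm)
    have hcx : Commute c x := by
      rw [inv_eq_of_mul_eq_one_left hc2, ← eq_mul_inv_iff_mul_eq,
        inv_eq_of_mul_eq_one_left hx2] at hxc
      exact hxc.symm
    have hcD : c ∉ D.range := by
      rw [hDr]
      rintro (hm | hm)
      · exact hc_not hm
      · exact hx ((Subgroup.mul_mem_cancel_right _ hcA).1 (hle hm))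
    obtain ⟨E, hE, hEr⟩ := exists_zmod_two_prod_hom hD hc2 hcD fun d => by
      rcases (hDr (D d)).1 ⟨d, rfl⟩ with hm | hm
      · exact hcz _ hm
      · have := hcx.mul_right (hcz _ hm)
        rwa [← mul_assoc, hx2, one_mul] at this
    refine ⟨(MulEquiv.ofBijective E ⟨hE, fun g => (hEr g).2 ?_⟩).symm⟩
    have hswap : x * (c * g) = c * (x * g) := by rw [← mul_assoc, ← hcx.eq, mul_assoc]
    rw [hDr, hDr, hswap]
    have := h.mem_or_mul_mem haA hbA hx g
    rw [hFr, hFr] at this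
    tauto

theorem mulEquiv_of_mul_self_eq (h : IsExceptionalPair a b) (ha : a ^ 6 = 1) (ha3 : a ^ 3 ≠ 1)
    (hab : a * a = b) :
    Nonempty (G ≃* Multiplicative (ZMod 6)) ∨ Nonempty (G ≃* DihedralGroup 6) := by
  have horder : orderOf a = 6 := by
    refine orderOf_eq_of_pow_and_pow_div_prime (by norm_num) ha fun p hp hdvd => ?_
    have hle := Nat.le_of_dvd (by norm_num) hdvd
    have h2 := h.left_ne
    rw [← sq] at h2
    interval_cases p <;> first | assumption | (exfalso; revert hp hdvd; decide)
  have haA := Subgroup.mem_zpowers a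
  have hbA : b ∈ Subgroup.zpowers a := hab ▸ mul_mem haA haA
  by_cases hA : Subgroup.zpowers a = ⊤
  · obtain ⟨z, hz, hzr⟩ := exists_zmod_hom horder
    exact Or.inl ⟨(MulEquiv.ofBijective z ⟨hz, MonoidHom.range_eq_top.1 (hzr.trans hA)⟩).symm⟩
  · right
    obtain ⟨x, hx⟩ : ∃ x, x ∉ Subgroup.zpowers a := by
      by_contra! hall
      exact hA ((Subgroup.eq_top_iff' _).2 hall)
    obtain ⟨hx2, hxa⟩ := h.mul_mul_eq_inv haA hbA hx haA
    obtain ⟨D, hD, hDr⟩ := exists_dihedral_hom horder hx2 hxa hx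
    exact ⟨(MulEquiv.ofBijective D
      ⟨hD, fun g => (hDr g).2 (h.mem_or_mul_mem haA hbA hx g)⟩).symm⟩

theorem mulEquiv_of_pow_six (h : IsExceptionalPair a b) (ha : a ^ 6 = 1) (ha3 : a ^ 3 ≠ 1)
    (ha4 : a ^ 4 ≠ 1) :
    Nonempty (G ≃* Multiplicative (ZMod 6)) ∨ Nonempty (G ≃* DihedralGroup 6) := by
  have hsq : a * a * (a * a) ≠ 1 := fun e => ha4 (by rw [← mul_self_mul_mul_self, e])
  rcases h.cover_of_ne hsq with e | e | e | e
  · exact absurd (mul_eq_left.1 e) h.left_ne_one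
  · exact absurd (by rw [pow_succ, sq, e, inv_mul_cancel]) ha3
  · exact h.mulEquiv_of_mul_self_eq ha ha3 e
  · exact h.inv_right.mulEquiv_of_mul_self_eq ha ha3 e

theorem mulEquiv_cases (h : IsExceptionalPair a b) :
    Nonempty (G ≃* Multiplicative (ZMod 6)) ∨
      Nonempty (G ≃* (Multiplicative (ZMod 2) × Multiplicative (ZMod 4))) ∨
      Nonempty (G ≃* DihedralGroup 6) ∨
      Nonempty (G ≃* (Multiplicative (ZMod 2) × DihedralGroup 4)) := by
  have hA := h.mulEquiv_of_pow_six
  have hB := h.symm.mulEquiv_of_pow_six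
  have hA3 := h.pow_three_ne_one
  have hB3 := h.symm.pow_three_ne_one
  have hfour := h.mulEquiv_of_pow_four
  have ha := h.pow_cases
  have hb := h.symm.pow_cases
  tauto

end IsExceptionalPair

theorem card_cyclic_subgroups_of_mulEquiv {G H : Type*} [Group G] [Group H] [Finite H] {a b : H}
    (h : IsExceptionalPair a b) (e : G ≃* H) :
    Nat.card {K : Subgroup G // IsCyclic K} = Nat.card G - 2 := by
  rw [card_cyclic_subgroups_congr e, h.card_cyclic_subgroups, Nat.card_congr e.toEquiv]

theorem card_cyclic_subgroups_eq_card_sub_two (G : Type*) [Group G] [Finite G] :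
    Nat.card {H : Subgroup G // IsCyclic H} = Nat.card G - 2 ↔
      (Nonempty (G ≃* Multiplicative (ZMod 6)) ∨
       Nonempty (G ≃* (Multiplicative (ZMod 2) × Multiplicative (ZMod 4))) ∨
       Nonempty (G ≃* DihedralGroup 6) ∨
       Nonempty (G ≃* (Multiplicative (ZMod 2) × DihedralGroup 4))) := by
  constructor
  · intro h
    obtain ⟨a, b, hab⟩ := exists_isExceptionalPair_of_card h
    exact hab.mulEquiv_cases
  · rintro (⟨⟨e⟩⟩ | ⟨⟨e⟩⟩ | ⟨⟨e⟩⟩ | ⟨⟨e⟩⟩)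
    · refine card_cyclic_subgroups_of_mulEquiv
        (a := Multiplicative.ofAdd (1 : ZMod 6)) (b := Multiplicative.ofAdd 2)
        ⟨by decide, by decide, zpowers_ne_of_forall_pow_ne (n := 3) ?_ ?_ ?_, ?_⟩ e <;> decide
    · refine card_cyclic_subgroups_of_mulEquiv
        (a := (Multiplicative.ofAdd (0 : ZMod 2), Multiplicative.ofAdd (1 : ZMod 4)))
        (b := (Multiplicative.ofAdd 1, Multiplicative.ofAdd 1))
        ⟨by decide, by decide, zpowers_ne_of_forall_pow_ne (n := 4) ?_ ?_ ?_, ?_⟩ e <;> decide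
    · refine card_cyclic_subgroups_of_mulEquiv
        (a := DihedralGroup.r (1 : ZMod 6)) (b := DihedralGroup.r 2)
        ⟨by decide, by decide, zpowers_ne_of_forall_pow_ne (n := 3) ?_ ?_ ?_, ?_⟩ e <;> decide
    · refine card_cyclic_subgroups_of_mulEquiv
        (a := (Multiplicative.ofAdd (0 : ZMod 2), DihedralGroup.r (1 : ZMod 4)))
        (b := (Multiplicative.ofAdd 1, DihedralGroup.r 1))
        ⟨by decide, by decide, zpowers_ne_of_forall_pow_ne (n := 4) ?_ ?_ ?_, ?_⟩ e <;> decide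
end

section
/- Let G be a finite group. Then the number of cyclic subgroups of G equals |G| if and only if G is an elementary abelian 2-group, i.e., every non-identity element of G has order 2. -/
/-- The cyclic subgroup generated by an element, as a member of the type of cyclic subgroups. -/
def cyclicSubgroupOf {G : Type*} [Group G] (g : G) : {H : Subgroup G // IsCyclic H} :=
  ⟨Subgroup.zpowers g, inferInstance⟩

theorem cyclicSubgroupOf_surjective (G : Type*) [Group G] :
    Function.Surjective (cyclicSubgroupOf : G → {H : Subgroup G // IsCyclic H}) := by
  rintro ⟨H, hH⟩
  obtain ⟨g, hg⟩ := (Subgroup.isCyclic_iff_exists_zpowers_eq_top H).mp hH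
  exact ⟨g, Subtype.ext hg⟩

theorem eq_one_or_eq_of_mem_zpowers_of_sq_eq_one {G : Type*} [Group G] {g h : G}
    (hh : h ^ 2 = 1) (hg : g ∈ Subgroup.zpowers h) : g = 1 ∨ g = h := by
  obtain ⟨k, rfl⟩ := Subgroup.mem_zpowers_iff.mp hg
  have hz : h ^ (2 : ℤ) = 1 := mod_cast hh
  obtain ⟨m, rfl | rfl⟩ := Int.even_or_odd' k
  · exact .inl (by rw [zpow_mul, hz, one_zpow])
  · exact .inr (by rw [zpow_add, zpow_mul, hz, one_zpow, one_mul, zpow_one])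

theorem cyclicSubgroupOf_injective_iff (G : Type*) [Group G] :
    Function.Injective (cyclicSubgroupOf : G → {H : Subgroup G // IsCyclic H}) ↔
      ∀ g : G, g ^ 2 = 1 := by
  constructor
  · intro hinj g
    have h : g⁻¹ = g := hinj (Subtype.ext (Subgroup.zpowers_inv (g := g)))
    rw [sq]
    nth_rewrite 1 [← h]
    exact inv_mul_cancel g
  · intro hsq g h hgh
    have hz : Subgroup.zpowers g = Subgroup.zpowers h := congrArg Subtype.val hgh
    rcases eq_one_or_eq_of_mem_zpowers_of_sq_eq_one (hsq h)
      (hz ▸ Subgroup.mem_zpowers g) with rfl | rfl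
    · rw [Subgroup.zpowers_one_eq_bot] at hz
      exact (Subgroup.zpowers_eq_bot.mp hz.symm).symm
    · rfl

theorem card_cyclic_subgroups_eq_card_iff (G : Type*) [Group G] [Finite G] :
    Nat.card {H : Subgroup G // IsCyclic H} = Nat.card G ↔
      ∀ g : G, g ≠ 1 → orderOf g = 2 := by
  trans Function.Injective (cyclicSubgroupOf : G → {H : Subgroup G // IsCyclic H})
  · constructor
    · intro h
      exact ((cyclicSubgroupOf_surjective G).bijective_of_nat_card_le h.ge).injective
    · intro h
      exact (Nat.card_eq_of_bijective _ ⟨h, cyclicSubgroupOf_surjective G⟩).symm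
  · rw [cyclicSubgroupOf_injective_iff]
    refine forall_congr' fun g ↦ ⟨fun h hg ↦ orderOf_eq_prime h hg, fun h ↦ ?_⟩
    by_cases hg : g = 1
    · rw [hg, one_pow]
    · rw [← h hg, pow_orderOf_eq_one]
end

section
/- Let G be a finite group. Then the number of cyclic subgroups of G equals |G| - 1 if and only if G is isomorphic to one of the following groups: the cyclic group Z/3Z, the cyclic group Z/4Z, the symmetric group S3, or the dihedral group D8 of order 8. -/
open Subgroup

/-- A group generated by an element `a` of order `n` and an involution `t` outside
`zpowers a` that inverts `a` is dihedral. -/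
theorem nonempty_mulEquiv_dihedralGroup {G : Type*} [Group G] {n : ℕ} {a t : G}
    (ha : orderOf a = n) (ht : t * t = 1) (hta : t * a * t⁻¹ = a⁻¹) (htz : t ∉ zpowers a)
    (h : ∀ g, g ∈ zpowers a ∨ t * g ∈ zpowers a) :
    Nonempty (G ≃* DihedralGroup n) := by
  have hzt (k : ℤ) : a ^ k * t = t * a ^ (-k) := by
    have hconj : t * a ^ (-k) * t⁻¹ = a ^ k := by
      rw [← conj_zpow, hta, inv_zpow', neg_neg]
    rw [← hconj, inv_mul_cancel_right]
  let φ : ZMod n →+ Additive G := ZMod.lift n ⟨zmultiplesHom (Additive G) (Additive.ofMul a), by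
    simp [← ha, ← ofMul_pow, pow_orderOf_eq_one]⟩
  have hφ (k : ℤ) : (φ k).toMul = a ^ k := by simp [φ]
  let F : DihedralGroup n → G
    | .r i => (φ i).toMul
    | .sr i => t * (φ i).toMul
  have hFr (k : ℤ) : F (.r k) = a ^ k := hφ k
  have hFsr (k : ℤ) : F (.sr k) = t * a ^ k := by rw [← hφ k]
  have hmul (x y : DihedralGroup n) : F (x * y) = F x * F y := by
    rcases x with i | i <;> rcases y with j | j <;>
      obtain ⟨i, rfl⟩ := ZMod.intCast_surjective i <;>
      obtain ⟨j, rfl⟩ := ZMod.intCast_surjective j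
    · rw [DihedralGroup.r_mul_r, ← Int.cast_add, hFr, hFr, hFr, zpow_add]
    · rw [DihedralGroup.r_mul_sr, ← Int.cast_sub, hFsr, hFr, hFsr, ← mul_assoc, hzt, mul_assoc,
        ← zpow_add, neg_add_eq_sub]
    · rw [DihedralGroup.sr_mul_r, ← Int.cast_add, hFsr, hFr, hFsr, zpow_add, mul_assoc]
    · rw [DihedralGroup.sr_mul_sr, ← Int.cast_sub, hFsr, hFr, hFsr, mul_assoc,
        ← mul_assoc _ t, hzt, ← mul_assoc, ← mul_assoc, ht, one_mul, ← zpow_add, neg_add_eq_sub]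
  let f : DihedralGroup n →* G := MonoidHom.mk' F hmul
  refine ⟨(MulEquiv.ofBijective f ⟨?_, fun g ↦ ?_⟩).symm⟩
  · rw [injective_iff_map_eq_one]
    rintro (i | i) hi <;> obtain ⟨k, rfl⟩ := ZMod.intCast_surjective i
    · have hk : a ^ k = 1 := (hFr k).symm.trans hi
      rw [← orderOf_dvd_iff_zpow_eq_one, ha] at hk
      rw [(CharP.intCast_eq_zero_iff (ZMod n) n k).mpr hk, DihedralGroup.r_zero]
    · have hk : t * a ^ k = 1 := (hFsr k).symm.trans hi
      exact absurd (eq_inv_of_mul_eq_one_left hk ▸ inv_mem (zpow_mem_zpowers a k)) htz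
  · obtain ⟨k, hk⟩ | ⟨k, hk⟩ := h g
    · exact ⟨.r k, (hFr k).trans hk⟩
    · refine ⟨.sr k, (hFsr k).trans ?_⟩
      rw [show a ^ k = t * g from hk, ← mul_assoc, ht, one_mul]

/-- Every element of `G` other than `a` and `a⁻¹` squares to `1`, while `a` does not. -/
def IsUniqueNonInvolution {G : Type*} [Group G] (a : G) : Prop :=
  a * a ≠ 1 ∧ ∀ x, x * x = 1 ∨ x = a ∨ x = a⁻¹

instance {G : Type*} [Group G] [Fintype G] [DecidableEq G] (a : G) :
    Decidable (IsUniqueNonInvolution a) :=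
  inferInstanceAs (Decidable (_ ∧ _))

namespace IsUniqueNonInvolution

variable {G : Type*} [Group G] {a : G}

theorem map {H : Type*} [Group H] (h : IsUniqueNonInvolution a) (e : G ≃* H) :
    IsUniqueNonInvolution (e a) := by
  refine ⟨by simpa [← map_mul] using h.1, fun x ↦ ?_⟩
  have := h.2 (e.symm x)
  rwa [← map_mul, EmbeddingLike.map_eq_one_iff, e.symm_apply_eq, e.symm_apply_eq, map_inv] at this

theorem orderOf_eq (h : IsUniqueNonInvolution a) : orderOf a = 3 ∨ orderOf a = 4 := by
  have h1 : a ≠ 1 := fun h1 ↦ h.1 (by simp [h1])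
  rcases h.2 (a * a) with h2 | h2 | h2
  · right
    exact orderOf_eq_prime_pow (p := 2) (n := 1) (by simpa [pow_two] using h.1)
      (by rw [← h2]; simp [pow_succ, mul_assoc])
  · exact absurd (mul_eq_left.mp h2) h1
  · left
    exact orderOf_eq_prime (by rw [pow_succ, pow_two, h2, inv_mul_cancel]) h1

theorem mem_zpowers_of_commute (h : IsUniqueNonInvolution a) {x : G} (hx : Commute x a) :
    x ∈ zpowers a := by
  rcases h.2 x with h1 | rfl | rfl
  · have key : x * a ∈ zpowers a := by
      rcases h.2 (x * a) with h2 | h2 | h2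
      · rw [hx.symm.mul_mul_mul_comm, h1, one_mul] at h2
        exact absurd h2 h.1
      · rw [h2]
        exact mem_zpowers a
      · rw [h2]
        exact inv_mem (mem_zpowers a)
    exact (mul_mem_cancel_right (mem_zpowers a)).mp key
  · exact mem_zpowers x
  · exact inv_mem (mem_zpowers a)

theorem conj_eq_inv (h : IsUniqueNonInvolution a) {x : G} (hx : x ∉ zpowers a) :
    x * a * x⁻¹ = a⁻¹ := by
  rcases h.2 (x * a * x⁻¹) with h1 | h1 | h1
  · refine absurd ?_ h.1
    rwa [conj_mul, conj_eq_one_iff] at h1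
  · exact absurd (h.mem_zpowers_of_commute (mul_inv_eq_iff_eq_mul.mp h1)) hx
  · exact h1

theorem nonempty_mulEquiv (h : IsUniqueNonInvolution a) :
    Nonempty (G ≃* Multiplicative (ZMod (orderOf a))) ∨
      Nonempty (G ≃* DihedralGroup (orderOf a)) := by
  by_cases hG : ∀ x, x ∈ zpowers a
  · left
    have : IsCyclic G := ⟨a, hG⟩
    refine ⟨?_⟩
    rw [orderOf_eq_card_of_forall_mem_zpowers hG]
    exact (zmodCyclicMulEquiv this).symm
  · right
    push Not at hG
    obtain ⟨t, ht⟩ := hG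
    have htt : t * t = 1 := by
      rcases h.2 t with h1 | h1 | h1
      · exact h1
      · exact absurd (h1 ▸ mem_zpowers a) ht
      · exact absurd (h1 ▸ inv_mem (mem_zpowers a)) ht
    refine nonempty_mulEquiv_dihedralGroup rfl htt (h.conj_eq_inv ht) ht fun g ↦ ?_
    refine or_iff_not_imp_left.mpr fun hg ↦ h.mem_zpowers_of_commute ?_
    have h1 := mul_inv_eq_iff_eq_mul.mp (h.conj_eq_inv hg)
    have h2 : t * a⁻¹ = a * t := by
      rw [← mul_inv_eq_iff_eq_mul, ← conj_inv, h.conj_eq_inv ht, inv_inv]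
    rw [commute_iff_eq, mul_assoc, h1, ← mul_assoc, h2, mul_assoc]

end IsUniqueNonInvolution

theorem eq_of_zpowers_eq_of_mul_self {G : Type*} [Group G] {x y : G} (hx : x * x = 1)
    (h : zpowers x = zpowers y) : x = y := by
  have key {x y : G} (hx : x * x = 1) (h : y ∈ zpowers x) : y = 1 ∨ y = x := by
    obtain ⟨k, rfl⟩ := h
    obtain ⟨m, rfl | rfl⟩ := k.even_or_odd'
    · left; simp [zpow_mul, pow_two, hx, zpow_ofNat]
    · right; simp [zpow_add, zpow_mul, pow_two, hx, zpow_ofNat]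
  rcases key hx (h ▸ mem_zpowers y) with rfl | rfl
  · simpa using h
  · rfl

theorem card_cyclic_subgroups_eq_card_sub_one_iff {G : Type*} [Group G] [Finite G] :
    Nat.card {H : Subgroup G // IsCyclic H} = Nat.card G - 1 ↔
      ∃ a : G, IsUniqueNonInvolution a := by
  let f : G → {H : Subgroup G // IsCyclic H} := fun x ↦ ⟨zpowers x, inferInstance⟩
  have hf (x y : G) : f x = f y ↔ zpowers x = zpowers y := Subtype.ext_iff
  have hinv (x : G) : f x⁻¹ = f x := by simp [hf]
  have hsurj : Function.Surjective f := fun ⟨H, hH⟩ ↦ by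
    obtain ⟨x, rfl⟩ := (Subgroup.isCyclic_iff_exists_zpowers_eq_top H).mp hH
    exact ⟨x, rfl⟩
  have hpos : 0 < Nat.card G := Nat.card_pos
  constructor
  · intro hcard
    obtain ⟨a, ha⟩ : ∃ a : G, a * a ≠ 1 := by
      by_contra! hsq
      have := Nat.card_eq_of_bijective f
        ⟨fun x y hxy ↦ eq_of_zpowers_eq_of_mul_self (hsq x) ((hf x y).mp hxy), hsurj⟩
      omega
    refine ⟨a, ha, fun x ↦ ?_⟩
    by_contra! ⟨hx, hxa, hxa'⟩
    have ha' : a ≠ a⁻¹ := fun h ↦ ha (mul_eq_one_iff_eq_inv.mpr h)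
    have hx' : x ≠ x⁻¹ := fun h ↦ hx (mul_eq_one_iff_eq_inv.mpr h)
    have hax : a ≠ x⁻¹ := fun h ↦ hxa' (by rw [h, inv_inv])
    have hsurj' : Function.Surjective (fun z : ({a⁻¹, x⁻¹}ᶜ : Set G) ↦ f z) := fun H ↦ by
      obtain ⟨z, rfl⟩ := hsurj H
      by_cases hz : z = a⁻¹
      · exact ⟨⟨a, by simp [ha', hax]⟩, by simp [hz, hinv]⟩
      by_cases hz' : z = x⁻¹
      · exact ⟨⟨x, by simp [hx', hxa']⟩, by simp [hz', hinv]⟩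
      · exact ⟨⟨z, by simp [hz, hz']⟩, rfl⟩
    have hle := Nat.card_le_card_of_surjective _ hsurj'
    have hadd := Set.ncard_add_ncard_compl ({a⁻¹, x⁻¹} : Set G)
    rw [Set.ncard_pair (by simpa using hxa.symm)] at hadd
    rw [Nat.card_coe_set_eq] at hle
    omega
  · rintro ⟨a, ha, h⟩
    have ha' : a ≠ a⁻¹ := fun h ↦ ha (mul_eq_one_iff_eq_inv.mpr h)
    have hbij : Function.Bijective (fun z : ({a⁻¹}ᶜ : Set G) ↦ f z) := by
      refine ⟨fun ⟨x, hx⟩ ⟨y, hy⟩ hxy ↦ Subtype.ext ?_, fun H ↦ ?_⟩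
      · have hxy' : zpowers x = zpowers y := (hf x y).mp hxy
        rcases h x with h1 | rfl | rfl
        · exact eq_of_zpowers_eq_of_mul_self h1 hxy'
        · rcases h y with h1 | rfl | rfl
          · exact (eq_of_zpowers_eq_of_mul_self h1 hxy'.symm).symm
          · rfl
          · exact absurd rfl hy
        · exact absurd rfl hx
      · obtain ⟨z, rfl⟩ := hsurj H
        by_cases hz : z = a⁻¹
        · exact ⟨⟨a, by simp [ha']⟩, by simp [hz, hinv]⟩
        · exact ⟨⟨z, by simp [hz]⟩, rfl⟩
    have hadd := Set.ncard_add_ncard_compl ({a⁻¹} : Set G)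
    rw [Set.ncard_singleton, ← Nat.card_coe_set_eq, Nat.card_eq_of_bijective _ hbij] at hadd
    omega

theorem nonempty_dihedralGroup_three_mulEquiv_perm :
    Nonempty (DihedralGroup 3 ≃* Equiv.Perm (Fin 3)) := by
  have h : IsUniqueNonInvolution (finRotate 3) := by decide
  have ho : orderOf (finRotate 3) = 3 := orderOf_eq_prime (by decide) (by decide)
  rcases h.nonempty_mulEquiv with ⟨⟨e⟩⟩ | ⟨⟨e⟩⟩
  · have := Nat.card_congr e.toEquiv
    simp [ho, Nat.card_eq_fintype_card, Fintype.card_perm, Nat.factorial] at this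
  · rw [ho] at e
    exact ⟨e.symm⟩



theorem card_cyclic_subgroups_eq_card_sub_one (G : Type*) [Group G] [Finite G] :
    Nat.card {H : Subgroup G // IsCyclic H} = Nat.card G - 1 ↔
      (Nonempty (G ≃* Multiplicative (ZMod 3)) ∨
       Nonempty (G ≃* Multiplicative (ZMod 4)) ∨
       Nonempty (G ≃* Equiv.Perm (Fin 3)) ∨
       Nonempty (G ≃* DihedralGroup 4)) := by
  rw [card_cyclic_subgroups_eq_card_sub_one_iff]
  constructor
  · rintro ⟨a, h⟩
    rcases h.orderOf_eq with ho | ho <;> have he := h.nonempty_mulEquiv <;> rw [ho] at he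
    · rcases he with he | ⟨⟨e⟩⟩
      · exact .inl he
      · obtain ⟨e'⟩ := nonempty_dihedralGroup_three_mulEquiv_perm
        exact .inr (.inr (.inl ⟨e.trans e'⟩))
    · rcases he with he | he
      · exact .inr (.inl he)
      · exact .inr (.inr (.inr he))
  · rintro (⟨⟨e⟩⟩ | ⟨⟨e⟩⟩ | ⟨⟨e⟩⟩ | ⟨⟨e⟩⟩)
    · have h : IsUniqueNonInvolution (Multiplicative.ofAdd (1 : ZMod 3)) := by decide
      exact ⟨_, h.map e.symm⟩
    · have h : IsUniqueNonInvolution (Multiplicative.ofAdd (1 : ZMod 4)) := by decide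
      exact ⟨_, h.map e.symm⟩
    · have h : IsUniqueNonInvolution (finRotate 3) := by decide
      exact ⟨_, h.map e.symm⟩
    · have h : IsUniqueNonInvolution (DihedralGroup.r (1 : ZMod 4)) := by decide
      exact ⟨_, h.map e.symm⟩
end

section
/- Let G be a finite group such that the number of cyclic subgroups of G equals |G| - 2. Then every element of G has order belonging to the set {1, 2, 3, 4, 6}. -/
theorem Nat.mem_of_totient_le_three {n : ℕ} (hn : 0 < n) (h : n.totient ≤ 3) :
    n ∈ ({1, 2, 3, 4, 6} : Set ℕ) := by
  have hd : ∀ d, d ∣ n → d.totient ≤ 3 := fun d hdn =>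
    (Nat.le_of_dvd (Nat.totient_pos.2 hn) (Nat.totient_dvd_of_dvd hdn)).trans h
  have h12 : n ∣ 12 := by
    rw [Nat.dvd_iff_prime_pow_dvd_dvd]
    intro p k hp hpk
    rcases Nat.eq_zero_or_pos k with rfl | hk
    · simp
    have hp4 : p ≤ 4 := by
      have := hd p ((dvd_pow_self p hk.ne').trans hpk)
      rw [Nat.totient_prime hp] at this
      omega
    have hp2 := hp.two_le
    interval_cases p
    · have : k ≤ 2 := by
        by_contra! hk3
        exact absurd (hd (2 ^ 3) ((pow_dvd_pow 2 hk3).trans hpk)) (by decide)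
      exact (pow_dvd_pow 2 this).trans (by norm_num)
    · have : k ≤ 1 := by
        by_contra! hk2
        exact absurd (hd (3 ^ 2) ((pow_dvd_pow 3 hk2).trans hpk)) (by decide)
      exact (pow_dvd_pow 3 this).trans (by norm_num)
    · exact absurd hp (by norm_num)
  have hle : n ≤ 12 := Nat.le_of_dvd (by norm_num) h12
  interval_cases n <;> first | simp; done | exact absurd h12 (by decide) | exact absurd h (by decide)

theorem Subgroup.zpowers_pow_of_coprime {G : Type*} [Group G] [Finite G] (g : G) {k : ℕ}
    (hk : (orderOf g).Coprime k) : Subgroup.zpowers (g ^ k) = Subgroup.zpowers g := by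
  apply Subgroup.eq_of_le_of_card_ge
  · rw [Subgroup.zpowers_le]
    exact Subgroup.npow_mem_zpowers g k
  · rw [Nat.card_zpowers, Nat.card_zpowers, hk.orderOf_pow]

theorem card_cyclic_add_totient_le {G : Type*} [Group G] [Finite G] (g : G) :
    Nat.card {H : Subgroup G // IsCyclic H} + (orderOf g).totient ≤ Nat.card G + 1 := by
  classical
  have := Fintype.ofFinite G
  have := Fintype.ofFinite {H : Subgroup G // IsCyclic H}
  let f : G → {H : Subgroup G // IsCyclic H} := fun x => ⟨Subgroup.zpowers x, inferInstance⟩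
  have hsum : Fintype.card G = ∑ H, (Finset.univ.filter fun x => f x = H).card :=
    Finset.card_eq_sum_card_fiberwise fun _ _ => Finset.mem_coe.2 (Finset.mem_univ _)
  have hpos : ∀ H, 1 ≤ (Finset.univ.filter fun x => f x = H).card := by
    rintro ⟨H, hH⟩
    obtain ⟨x, hx⟩ := (Subgroup.isCyclic_iff_exists_zpowers_eq_top H).1 hH
    exact Finset.card_pos.2 ⟨x, by simpa [f] using hx⟩
  have hg : (orderOf g).totient ≤ (Finset.univ.filter fun x => f x = f g).card := by
    refine Finset.card_le_card_of_injOn (fun k => g ^ k) ?_ ?_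
    · intro k hk
      simp only [Finset.coe_filter, Finset.mem_range, Set.mem_ofPred_eq] at hk
      simpa [f] using Subgroup.zpowers_pow_of_coprime g hk.2
    · refine pow_injOn_Iio_orderOf.mono fun k hk => ?_
      simp only [Finset.coe_filter, Finset.mem_range, Set.mem_ofPred_eq] at hk
      exact hk.1
  have herase : (Finset.univ.erase (f g)).card ≤
      ∑ H ∈ Finset.univ.erase (f g), (Finset.univ.filter fun x => f x = H).card := by
    rw [Finset.card_eq_sum_ones]
    exact Finset.sum_le_sum fun H _ => hpos H
  rw [← Finset.add_sum_erase _ _ (Finset.mem_univ (f g))] at hsum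
  rw [Finset.card_erase_of_mem (Finset.mem_univ _), Finset.card_univ] at herase
  rw [Nat.card_eq_fintype_card, Nat.card_eq_fintype_card]
  omega

theorem orderOf_mem_of_card_cyclic_eq_sub_two (G : Type*) [Group G] [Finite G]
    (h : Nat.card {H : Subgroup G // IsCyclic H} = Nat.card G - 2) :
    ∀ g : G, orderOf g ∈ ({1, 2, 3, 4, 6} : Set ℕ) := by
  intro g
  have hle := card_cyclic_add_totient_le g
  exact Nat.mem_of_totient_le_three (orderOf_pos g) (by omega)
end

section
/- Let G be a finite group such that the number of cyclic subgroups of G equals |G| - 2. Then exactly one of the following holds: (a) G has exactly two cyclic subgroups of order 4 and every other nontrivial cyclic subgroup of G has order 2; or (b) G has exactly one cyclic subgroup of order 3, exactly one cyclic subgroup of order 6, and every other nontrivial cyclic subgroup of G has order 2. -/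
theorem Nat.eq_of_totient_eq_two {n : ℕ} (h : n.totient = 2) : n = 3 ∨ n = 4 ∨ n = 6 := by
  have hn : 6 < n → ∃ k, 1 < k ∧ k + 1 < n ∧ n.Coprime k := by
    intro hn
    rcases Nat.even_or_odd' n with ⟨m, rfl | rfl⟩
    · rcases Nat.even_or_odd' m with ⟨l, rfl | rfl⟩
      · refine ⟨2 * l + 1, by omega, by omega, ?_⟩
        have : Nat.Coprime (2 * l) (2 * l + 1) := by simp
        exact Nat.Coprime.mul_left (by simp) this
      · refine ⟨2 * l + 1 + 2, by omega, by omega, ?_⟩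
        refine Nat.Coprime.mul_left (by simp) ?_
        simp
    · exact ⟨2, by omega, by omega, by simp⟩
  by_cases h6 : 6 < n
  · obtain ⟨k, h1, h2, h3⟩ := hn h6
    have hsub : ({1, k, n - 1} : Finset ℕ) ⊆ {a ∈ Finset.range n | n.Coprime a} := by
      intro a ha
      simp only [Finset.mem_insert, Finset.mem_singleton] at ha
      simp only [Finset.mem_filter, Finset.mem_range]
      rcases ha with rfl | rfl | rfl
      · exact ⟨by omega, by simp⟩
      · exact ⟨by omega, h3⟩
      · refine ⟨by omega, ?_⟩
        obtain ⟨m, rfl⟩ : ∃ m, n = m + 1 := ⟨n - 1, by omega⟩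
        simp
    have := Finset.card_le_card hsub
    rw [Finset.card_eq_three.2 ⟨1, k, n - 1, by omega, by omega, by omega, rfl⟩] at this
    rw [Nat.totient] at h
    omega
  · push Not at h6
    interval_cases n <;> revert h <;> decide

namespace Subgroup

variable {G : Type*} [Group G]

open Classical in
theorem card_filter_zpowers_eq [Fintype G] (H : Subgroup G) (hH : IsCyclic H) :
    (Finset.univ.filter fun g : G => zpowers g = H).card = (Nat.card H).totient := by
  rw [Nat.card_eq_fintype_card, ← IsCyclic.card_orderOf_eq_totient (α := H) dvd_rfl,
    ← Finset.card_map (Function.Embedding.subtype (· ∈ H))]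
  congr 1
  ext g
  simp only [Finset.mem_filter, Finset.mem_univ, true_and, Finset.mem_map,
    Function.Embedding.subtype_apply, Subtype.exists, exists_and_right, exists_eq_right,
    ← Nat.card_eq_fintype_card]
  constructor
  · rintro rfl
    exact ⟨mem_zpowers g, by rw [Subgroup.orderOf_mk, Nat.card_zpowers]⟩
  · rintro ⟨hg, ho⟩
    rw [Subgroup.orderOf_mk, ← Nat.card_zpowers] at ho
    exact Subgroup.eq_of_le_of_card_ge (zpowers_le.2 hg) ho.ge

open Classical in
theorem sum_totient_card_isCyclic [Fintype G] :
    ∑ H ∈ Finset.univ.filter (fun H : Subgroup G => IsCyclic H), (Nat.card H).totient =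
      Nat.card G := by
  rw [Nat.card_eq_fintype_card, ← Finset.card_univ,
    Finset.card_eq_sum_card_fiberwise (f := fun g : G => zpowers g)
      (t := Finset.univ.filter fun H : Subgroup G => IsCyclic H)]
  · exact Finset.sum_congr rfl fun H hH =>
      (card_filter_zpowers_eq H (Finset.mem_filter.1 hH).2).symm
  · intro g _
    simpa using (inferInstance : IsCyclic (zpowers g))

theorem eq_zpowers_of_isCyclic (H : Subgroup G) (hH : IsCyclic H) : ∃ x, H = zpowers x := by
  obtain ⟨x, hx⟩ := (Subgroup.isCyclic_iff_exists_zpowers_eq_top H).1 hH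
  exact ⟨x, hx.symm⟩

/-- If the number of cyclic subgroups is `|G| - 2`, exactly two of them have order greater
than two, and these have order 3, 4 or 6. -/
theorem exists_zpowers_of_card_isCyclic_eq [Finite G]
    (h : Nat.card {H : Subgroup G // IsCyclic H} = Nat.card G - 2) :
    ∃ x y : G, zpowers x ≠ zpowers y ∧
      (orderOf x = 3 ∨ orderOf x = 4 ∨ orderOf x = 6) ∧
      (orderOf y = 3 ∨ orderOf y = 4 ∨ orderOf y = 6) ∧
      ∀ g : G, 2 < orderOf g → zpowers g = zpowers x ∨ zpowers g = zpowers y := by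
  classical
  have := Fintype.ofFinite G
  set C := Finset.univ.filter fun H : Subgroup G => IsCyclic H with hC
  have hcard : Nat.card {H : Subgroup G // IsCyclic H} = C.card := by
    rw [Nat.card_eq_fintype_card, Fintype.card_subtype]
  have hsum := sum_totient_card_isCyclic (G := G)
  have hpos : 0 < C.card :=
    Finset.card_pos.2 ⟨⊥, by simpa [hC] using (inferInstance : IsCyclic (⊥ : Subgroup G))⟩
  set S := C.filter fun H : Subgroup G => 2 < Nat.card H with hS
  have hS_le : ∀ H ∈ S, 2 ≤ (Nat.card H).totient ∧ Even (Nat.card H).totient := by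
    intro H hH
    have h2 := (Finset.mem_filter.1 hH).2
    have he := Nat.totient_even h2
    have := Nat.totient_pos.2 (show 0 < Nat.card H by omega)
    exact ⟨by obtain ⟨k, hk⟩ := he; omega, he⟩
  have hexcess : ∑ H ∈ S, ((Nat.card H).totient - 1) = 2 := by
    have h1 : ∑ H ∈ C, ((Nat.card H).totient - 1) + C.card = Nat.card G := by
      rw [Finset.card_eq_sum_ones, ← Finset.sum_add_distrib, ← hsum]
      refine Finset.sum_congr rfl fun H _ => ?_
      have := Nat.totient_pos.2 (Nat.card_pos (α := H))
      omega
    have h2 : ∑ H ∈ S, ((Nat.card H).totient - 1) = ∑ H ∈ C, ((Nat.card H).totient - 1) := by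
      refine Finset.sum_filter_of_ne fun H _ hne => ?_
      by_contra hle
      have := Nat.totient_le (Nat.card H)
      have h2 : (Nat.card H) = 2 := by omega
      rw [h2] at hne
      exact hne rfl
    omega
  have hS2 : S.card = 2 := by
    have hle : S.card ≤ 2 := by
      rw [← hexcess, Finset.card_eq_sum_ones]
      exact Finset.sum_le_sum fun H hH => by have := hS_le H hH; omega
    have h0 : S.card ≠ 0 := by
      intro h0
      simp [Finset.card_eq_zero.1 h0] at hexcess
    have h1 : S.card ≠ 1 := by
      intro h1
      obtain ⟨H, hH⟩ := Finset.card_eq_one.1 h1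
      obtain ⟨-, k, hk⟩ := hS_le H (by simp [hH])
      rw [hH, Finset.sum_singleton] at hexcess
      omega
    omega
  obtain ⟨H, K, hne, hHK⟩ := Finset.card_eq_two.1 hS2
  rw [hHK, Finset.sum_pair hne] at hexcess
  have hHS : H ∈ S := by simp [hHK]
  have hKS : K ∈ S := by simp [hHK]
  have hH := hS_le H hHS
  have hK := hS_le K hKS
  obtain ⟨x, rfl⟩ := eq_zpowers_of_isCyclic H
    (Finset.mem_filter.1 (Finset.mem_filter.1 hHS).1).2
  obtain ⟨y, rfl⟩ := eq_zpowers_of_isCyclic K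
    (Finset.mem_filter.1 (Finset.mem_filter.1 hKS).1).2
  simp only [Nat.card_zpowers] at hexcess hH hK
  refine ⟨x, y, hne, Nat.eq_of_totient_eq_two (by omega), Nat.eq_of_totient_eq_two (by omega),
    fun g hg => ?_⟩
  have : zpowers g ∈ S := by
    simp only [hS, hC, Finset.mem_filter, Finset.mem_univ, true_and, Nat.card_zpowers]
    exact ⟨inferInstance, hg⟩
  simpa [hHK] using this

theorem eq_or_eq_inv_of_zpowers_eq {x g : G} (hx : orderOf x = 3) (h : zpowers g = zpowers x) :
    g = x ∨ g = x⁻¹ := by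
  have h3 : x ^ 3 = 1 := hx ▸ pow_orderOf_eq_one x
  have hinv : x ^ 2 = x⁻¹ := eq_inv_of_mul_eq_one_left (by rw [← pow_succ, h3])
  have hg : g ∈ zpowers x := h ▸ mem_zpowers g
  have hfin : IsOfFinOrder x := orderOf_pos_iff.1 (by omega)
  classical
  obtain ⟨k, hk, rfl⟩ := Finset.mem_image.1 (hfin.mem_zpowers_iff_mem_range_orderOf.1 hg)
  rw [Finset.mem_range, hx] at hk
  interval_cases k
  · exfalso
    rw [pow_zero, zpowers_one_eq_bot, eq_comm, zpowers_eq_bot] at h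
    simp [h] at hx
  · simp
  · exact .inr hinv

theorem orderOf_conj (y x : G) : orderOf (y * x * y⁻¹) = orderOf x := by
  simpa using (MulAut.conj y).orderOf_eq x

/-- If two distinct subgroups have order 3, some further cyclic subgroup has order greater than
two. -/
theorem not_orderOf_three_three {x y : G} (hne : zpowers x ≠ zpowers y) (hx : orderOf x = 3)
    (hy : orderOf y = 3)
    (hall : ∀ g : G, 2 < orderOf g → zpowers g = zpowers x ∨ zpowers g = zpowers y) : False := by
  have hx3 : x ^ 3 = 1 := hx ▸ pow_orderOf_eq_one x
  have hy3 : y ^ 3 = 1 := hy ▸ pow_orderOf_eq_one y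
  have hx1 : x ≠ 1 := by rintro rfl; simp at hx
  have hy1 : y ≠ 1 := by rintro rfl; simp at hy
  have hyx : y ≠ x := by rintro rfl; exact hne rfl
  have hyx' : y ≠ x⁻¹ := by rintro rfl; exact hne zpowers_inv.symm
  have key : ∀ g : G, g ^ 3 = 1 → g ≠ 1 → g = x ∨ g = x⁻¹ ∨ g = y ∨ g = y⁻¹ := by
    intro g hg3 hg1
    have ho : orderOf g = 3 := orderOf_eq_prime hg3 hg1
    rcases hall g (by omega) with h | h
    · rcases eq_or_eq_inv_of_zpowers_eq hx h with h | h <;> simp [h]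
    · rcases eq_or_eq_inv_of_zpowers_eq hy h with h | h <;> simp [h]
  have hcomm : x * y = y * x := by
    rcases key (x * y * x⁻¹) (by rw [conj_pow, hy3]; simp) (by simpa using hy1) with h | h | h | h
    · exact absurd (by simpa using mul_inv_eq_iff_eq_mul.1 h) hyx
    · rw [mul_inv_eq_iff_eq_mul, inv_mul_cancel] at h
      exact absurd (eq_inv_of_mul_eq_one_right h) hyx'
    · exact mul_inv_eq_iff_eq_mul.1 h
    · have h1 := mul_inv_eq_iff_eq_mul.1 h
      have h2 : x * y⁻¹ = y * x := by
        rw [← mul_inv_eq_iff_eq_mul, ← conj_inv, h, inv_inv]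
      have h3 : x ^ 3 * y = y⁻¹ * x ^ 3 := by
        calc x ^ 3 * y = x * x * (x * y) := by simp [pow_succ, mul_assoc]
          _ = x * (x * y⁻¹) * x := by rw [h1]; simp [mul_assoc]
          _ = x * y * x * x := by rw [h2]; simp [mul_assoc]
          _ = y⁻¹ * x ^ 3 := by rw [h1]; simp [pow_succ, mul_assoc]
      rw [hx3, one_mul, mul_one] at h3
      have : orderOf y ∣ 2 := orderOf_dvd_of_pow_eq_one (by
        rw [pow_two]; nth_rewrite 1 [h3]; simp)
      rw [hy] at this
      omega
  rcases key (x * y) (by rw [(show Commute x y from hcomm).mul_pow, hx3, hy3, one_mul])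
    (fun h => hyx' (eq_inv_of_mul_eq_one_right h)) with h | h | h | h
  · exact hy1 (by simpa using h)
  · have : y = x⁻¹ * x⁻¹ := eq_inv_mul_of_mul_eq h
    refine hyx (this.trans ?_)
    rw [← mul_inv_rev, inv_eq_iff_mul_eq_one, ← pow_two, ← pow_succ, hx3]
  · exact hx1 (by simpa using h)
  · have : x = y⁻¹ * y⁻¹ := eq_mul_inv_of_mul_eq h
    refine hyx (Eq.symm (this.trans ?_))
    rw [← mul_inv_rev, inv_eq_iff_mul_eq_one, ← pow_two, ← pow_succ, hy3]

/-- An element of order 4 has a square centralizing a unique subgroup of order 3, which gives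
an element of order 6. -/
theorem not_orderOf_three_four {x y : G} (hx : orderOf x = 3) (hy : orderOf y = 4)
    (hall : ∀ g : G, 2 < orderOf g → zpowers g = zpowers x ∨ zpowers g = zpowers y) : False := by
  have hconj : y * x * y⁻¹ = x ∨ y * x * y⁻¹ = x⁻¹ := by
    have ho : orderOf (y * x * y⁻¹) = 3 := by rw [orderOf_conj, hx]
    rcases hall (y * x * y⁻¹) (by omega) with h | h
    · exact eq_or_eq_inv_of_zpowers_eq hx h
    · have := congrArg (fun H : Subgroup G => Nat.card H) h
      simp only [Nat.card_zpowers] at this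
      omega
  have hcomm : Commute x (y ^ 2) := by
    have h2 : y * (y * x * y⁻¹) * y⁻¹ = x := by
      rcases hconj with h | h
      · rw [h, h]
      · rw [h, ← conj_inv, h, inv_inv]
    rw [mul_inv_eq_iff_eq_mul, ← mul_assoc, mul_inv_eq_iff_eq_mul] at h2
    rw [Commute, SemiconjBy, pow_two, ← mul_assoc, ← h2, mul_assoc]
  have hy2 : orderOf (y ^ 2) = 2 := by
    rw [orderOf_pow_of_dvd (by norm_num) (by rw [hy]; norm_num), hy]
  have h6 : orderOf (x * y ^ 2) = 6 := by
    rw [hcomm.orderOf_mul_eq_mul_orderOf_of_coprime (by rw [hx, hy2]; norm_num), hx, hy2]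
  rcases hall (x * y ^ 2) (by omega) with h | h
  all_goals
    have := congrArg (fun H : Subgroup G => Nat.card H) h
    simp only [Nat.card_zpowers] at this
    omega

theorem orderOf_eq_three_of_orderOf_eq_six {x y : G} (hx : orderOf x = 6)
    (hall : ∀ g : G, 2 < orderOf g → zpowers g = zpowers x ∨ zpowers g = zpowers y) :
    orderOf y = 3 := by
  have hx2 : orderOf (x ^ 2) = 3 := by
    rw [orderOf_pow_of_dvd (by norm_num) (by rw [hx]; norm_num), hx]
  rcases hall (x ^ 2) (by omega) with h | h
  all_goals
    have := congrArg (fun H : Subgroup G => Nat.card H) h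
    simp only [Nat.card_zpowers] at this
    omega

theorem card_eq_two_of_ne_bot [Finite G] {H : Subgroup G} (h : H ≠ ⊥) (h2 : Nat.card H ≤ 2) :
    Nat.card H = 2 := by
  have := (Subgroup.one_lt_card_iff_ne_bot H).2 h
  omega

theorem card_three_six_of_orderOf [Finite G] {x y : G} (hx : orderOf x = 6) (hy : orderOf y = 3)
    (hall : ∀ g : G, 2 < orderOf g → zpowers g = zpowers x ∨ zpowers g = zpowers y) :
    Nat.card {H : Subgroup G // IsCyclic H ∧ Nat.card H = 3} = 1 ∧
      Nat.card {H : Subgroup G // IsCyclic H ∧ Nat.card H = 6} = 1 ∧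
      ∀ H : Subgroup G, IsCyclic H → H ≠ ⊥ → Nat.card H ≠ 3 → Nat.card H ≠ 6 →
        Nat.card H = 2 := by
  have hcyc : ∀ H : Subgroup G, IsCyclic H → 2 < Nat.card H → H = zpowers x ∨ H = zpowers y := by
    intro H hH h2
    obtain ⟨g, rfl⟩ := eq_zpowers_of_isCyclic H hH
    exact hall g (by rwa [Nat.card_zpowers] at h2)
  have hcx : Nat.card (zpowers x) = 6 := by rw [Nat.card_zpowers, hx]
  have hcy : Nat.card (zpowers y) = 3 := by rw [Nat.card_zpowers, hy]
  refine ⟨Nat.card_eq_one_iff_exists.2 ⟨⟨zpowers y, inferInstance, hcy⟩, ?_⟩,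
    Nat.card_eq_one_iff_exists.2 ⟨⟨zpowers x, inferInstance, hcx⟩, ?_⟩, ?_⟩
  · rintro ⟨H, hH, hc⟩
    rcases hcyc H hH (by omega) with rfl | rfl
    · omega
    · rfl
  · rintro ⟨H, hH, hc⟩
    rcases hcyc H hH (by omega) with rfl | rfl
    · rfl
    · omega
  · intro H hH hb h3 h6
    refine card_eq_two_of_ne_bot hb (not_lt.1 fun h2 => ?_)
    rcases hcyc H hH h2 with rfl | rfl <;> contradiction

theorem card_four_of_orderOf [Finite G] {x y : G} (hne : zpowers x ≠ zpowers y)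
    (hx : orderOf x = 4) (hy : orderOf y = 4)
    (hall : ∀ g : G, 2 < orderOf g → zpowers g = zpowers x ∨ zpowers g = zpowers y) :
    Nat.card {H : Subgroup G // IsCyclic H ∧ Nat.card H = 4} = 2 ∧
      ∀ H : Subgroup G, IsCyclic H → H ≠ ⊥ → Nat.card H ≠ 4 → Nat.card H = 2 := by
  have hcyc : ∀ H : Subgroup G, IsCyclic H → 2 < Nat.card H → H = zpowers x ∨ H = zpowers y := by
    intro H hH h2
    obtain ⟨g, rfl⟩ := eq_zpowers_of_isCyclic H hH
    exact hall g (by rwa [Nat.card_zpowers] at h2)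
  have hcx : Nat.card (zpowers x) = 4 := by rw [Nat.card_zpowers, hx]
  have hcy : Nat.card (zpowers y) = 4 := by rw [Nat.card_zpowers, hy]
  refine ⟨Nat.card_eq_two_iff.2 ⟨⟨zpowers x, inferInstance, hcx⟩, ⟨zpowers y, inferInstance, hcy⟩,
    fun h => hne (congrArg Subtype.val h), Set.eq_univ_of_forall ?_⟩, ?_⟩
  · rintro ⟨H, hH, hc⟩
    simpa using hcyc H hH (by omega)
  · intro H hH hb h4
    refine card_eq_two_of_ne_bot hb (not_lt.1 fun h2 => ?_)
    rcases hcyc H hH h2 with rfl | rfl <;> contradiction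

end Subgroup

theorem cyclic_subgroup_structure_of_card_eq_sub_two (G : Type*) [Group G] [Finite G]
    (h : Nat.card {H : Subgroup G // IsCyclic H} = Nat.card G - 2) :
    Xor'
      (Nat.card {H : Subgroup G // IsCyclic H ∧ Nat.card H = 4} = 2 ∧
        ∀ H : Subgroup G, IsCyclic H → H ≠ ⊥ → Nat.card H ≠ 4 → Nat.card H = 2)
      (Nat.card {H : Subgroup G // IsCyclic H ∧ Nat.card H = 3} = 1 ∧
        Nat.card {H : Subgroup G // IsCyclic H ∧ Nat.card H = 6} = 1 ∧
        ∀ H : Subgroup G, IsCyclic H → H ≠ ⊥ → Nat.card H ≠ 3 → Nat.card H ≠ 6 →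
          Nat.card H = 2) := by
  obtain ⟨x, y, hne, hx, hy, hall⟩ := Subgroup.exists_zpowers_of_card_isCyclic_eq h
  have hall' := fun g hg => (hall g hg).symm
  have not_both : ∀ {P₃ P₆ : Prop},
      (∀ H : Subgroup G, IsCyclic H → H ≠ ⊥ → Nat.card H ≠ 4 → Nat.card H = 2) →
      (P₃ ∧ P₆ ∧ ∀ H : Subgroup G, IsCyclic H → H ≠ ⊥ → Nat.card H ≠ 3 → Nat.card H ≠ 6 →
        Nat.card H = 2) → False := by
    intro _ _ h4 ⟨_, _, h36⟩
    have hx' : Nat.card (Subgroup.zpowers x) = orderOf x := Nat.card_zpowers x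
    have hb : Subgroup.zpowers x ≠ ⊥ :=
      (Subgroup.one_lt_card_iff_ne_bot _).1 (by omega)
    have h1 := h4 _ inferInstance hb
    have h2 := h36 _ inferInstance hb
    omega
  rcases hx with hx | hx | hx
  · rcases hy with hy | hy | hy
    · exact (Subgroup.not_orderOf_three_three hne hx hy hall).elim
    · exact (Subgroup.not_orderOf_three_four hx hy hall).elim
    · have hb := Subgroup.card_three_six_of_orderOf hy hx hall'
      exact .inr ⟨hb, fun ha => not_both ha.2 hb⟩
  · rcases hy with hy | hy | hy
    · exact (Subgroup.not_orderOf_three_four hy hx hall').elim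
    · have ha := Subgroup.card_four_of_orderOf hne hx hy hall
      exact .inl ⟨ha, fun hb => not_both ha.2 hb⟩
    · have := Subgroup.orderOf_eq_three_of_orderOf_eq_six hy hall'
      omega
  · have hb := Subgroup.card_three_six_of_orderOf hx
      (Subgroup.orderOf_eq_three_of_orderOf_eq_six hx hall) hall
    exact .inr ⟨hb, fun ha => not_both ha.2 hb⟩
end

section
/- Let G be a finite group of order 8 such that the number of cyclic subgroups of G equals 6. Then G is isomorphic to Z/2Z × Z/4Z. -/
open Subgroup

lemma card_cyclic_subgroups_le {G : Type*} [Group G] (S : Finset G)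
    (hS : ∀ x : G, x ∈ S ∨ x⁻¹ ∈ S) : Nat.card {H : Subgroup G // IsCyclic H} ≤ S.card := by
  have hsurj : Function.Surjective
      (fun x : S ↦ (⟨zpowers x.1, inferInstance⟩ : {H : Subgroup G // IsCyclic H})) := by
    rintro ⟨H, hH⟩
    obtain ⟨x, rfl⟩ := H.isCyclic_iff_exists_zpowers_eq_top.mp hH
    rcases hS x with hx | hx
    · exact ⟨⟨x, hx⟩, rfl⟩
    · exact ⟨⟨x⁻¹, hx⟩, Subtype.ext (zpowers_inv)⟩
  simpa using Nat.card_le_card_of_surjective _ hsurj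

lemma ncard_le_card_cyclic_subgroups {G : Type*} [Group G] [Finite G] (S : Set G)
    (hS : S.InjOn zpowers) : S.ncard ≤ Nat.card {H : Subgroup G // IsCyclic H} := by
  have hinj : Function.Injective
      (fun x : S ↦ (⟨zpowers x.1, inferInstance⟩ : {H : Subgroup G // IsCyclic H})) :=
    fun x y hxy ↦ Subtype.ext (hS x.2 y.2 (congrArg Subtype.val hxy))
  exact Nat.card_le_card_of_injective _ hinj

lemma eq_of_zpowers_eq_of_sq_eq_one {G : Type*} [Group G] {x y : G} (hx : x ^ 2 = 1)
    (h : zpowers x = zpowers y) : x = y := by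
  obtain ⟨k, hk⟩ := mem_zpowers_iff.mp (h ▸ mem_zpowers y : y ∈ zpowers x)
  rcases Int.even_or_odd' k with ⟨m, rfl | rfl⟩
  · have hy : y = 1 := by
      rw [← hk, zpow_mul, zpow_ofNat, hx, one_zpow]
    rw [hy, zpowers_one_eq_bot, zpowers_eq_bot] at h
    rw [h, hy]
  · rw [← hk, zpow_add, zpow_mul, zpow_ofNat, hx, one_zpow, one_mul, zpow_one]

lemma exists_pow_eq_of_mem_zpowers {G : Type*} [Group G] [Finite G] {a x : G} {n : ℕ}
    (ha : orderOf a = n) (hx : x ∈ zpowers a) : ∃ i < n, a ^ i = x := by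
  classical
  rw [mem_zpowers_iff_mem_range_orderOf, ha] at hx
  simpa using hx

/-- A group of order `8` is the internal direct product of the subgroups generated by commuting
elements `b` of order `2` and `a` of order `4` with `b ∉ zpowers a`. -/
lemma nonempty_mulEquiv_of_commute {G : Type*} [Group G] [Finite G] (hG : Nat.card G = 8)
    {a b : G} (ha : orderOf a = 4) (hb : b ^ 2 = 1) (hba : b ∉ zpowers a) (hab : Commute b a) :
    Nonempty (G ≃* (Multiplicative (ZMod 2) × Multiplicative (ZMod 4))) := by
  have hb1 : b ≠ 1 := fun h ↦ hba (h ▸ one_mem _)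
  have hb2 : orderOf b = 2 := orderOf_eq_prime hb hb1
  let e₁ : Multiplicative (ZMod 2) ≃* zpowers b := mulEquivOfCyclicCardEq (by simp [hb2])
  let e₂ : Multiplicative (ZMod 4) ≃* zpowers a := mulEquivOfCyclicCardEq (by simp [ha])
  let f₁ := (zpowers b).subtype.comp e₁.toMonoidHom
  let f₂ := (zpowers a).subtype.comp e₂.toMonoidHom
  have hf₁ (x) : f₁ x ∈ zpowers b := (e₁ x).2
  have hf₂ (x) : f₂ x ∈ zpowers a := (e₂ x).2
  have hcomm (x y) : Commute (f₁ x) (f₂ y) := by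
    obtain ⟨i, hi⟩ := mem_zpowers_iff.mp (hf₁ x)
    obtain ⟨j, hj⟩ := mem_zpowers_iff.mp (hf₂ y)
    rw [← hi, ← hj]
    exact hab.zpow_zpow i j
  have hinj : Function.Injective (MonoidHom.noncommCoprod f₁ f₂ hcomm) := by
    rw [MonoidHom.noncommCoprod_injective]
    refine ⟨Subtype.val_injective.comp e₁.injective, Subtype.val_injective.comp e₂.injective, ?_⟩
    rw [disjoint_def]
    rintro _ ⟨x, rfl⟩ ⟨y, hy⟩
    have hmem : f₁ x ∈ zpowers a := hy ▸ hf₂ y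
    obtain ⟨i, hi, hi'⟩ := exists_pow_eq_of_mem_zpowers hb2 (hf₁ x)
    interval_cases i
    · simpa using hi'.symm
    · rw [pow_one] at hi'
      exact absurd (hi' ▸ hmem) hba
  exact ⟨(MulEquiv.ofBijective _ (hinj.bijective_of_nat_card_le (by simp [hG]))).symm⟩

lemma mul_mul_inv_eq_self_or_inv {G : Type*} [Group G] [Finite G] {a : G} (ha : orderOf a = 4)
    (hA : (zpowers a).Normal) (b : G) : b * a * b⁻¹ = a ∨ b * a * b⁻¹ = a⁻¹ := by
  obtain ⟨i, hi, h⟩ := exists_pow_eq_of_mem_zpowers ha (hA.conj_mem a (mem_zpowers a) b)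
  have ha4 : a ^ 4 = 1 := ha ▸ pow_orderOf_eq_one a
  have hne : (b * a * b⁻¹) ^ 2 ≠ 1 := by
    rw [conj_pow, Ne, conj_eq_one_iff]
    exact pow_ne_one_of_lt_orderOf two_ne_zero (by omega)
  rw [← h] at hne ⊢
  interval_cases i
  · simp at hne
  · simp
  · exact absurd (by rw [← pow_mul, ha4]) hne
  · exact .inr (eq_inv_of_mul_eq_one_left (by rw [← pow_succ, ha4]))

theorem group_of_order_eight_with_six_cyclic_subgroups (G : Type*) [Group G] [Finite G]
    (hG : Nat.card G = 8) (h : Nat.card {H : Subgroup G // IsCyclic H} = 6) :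
    Nonempty (G ≃* (Multiplicative (ZMod 2) × Multiplicative (ZMod 4))) := by
  classical
  have hno8 (a : G) : orderOf a ≠ 8 := by
    intro ha
    have ha8 : a ^ 8 = 1 := ha ▸ pow_orderOf_eq_one a
    have hle := card_cyclic_subgroups_le {1, a, a ^ 2, a ^ 3, a ^ 4} (fun x ↦ by
      have hx : x ∈ zpowers a := by
        rw [eq_top_of_card_eq (zpowers a) (by simp [ha, hG])]
        trivial
      obtain ⟨i, hi, rfl⟩ := exists_pow_eq_of_mem_zpowers ha hx
      by_cases h4 : i ≤ 4
      · left
        interval_cases i <;> simp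
      · right
        have hinv : (a ^ i)⁻¹ = a ^ (8 - i) :=
          inv_eq_of_mul_eq_one_right (by rw [← pow_add, Nat.add_sub_cancel' hi.le, ha8])
        rw [hinv]
        interval_cases i <;> simp)
    have := hle.trans Finset.card_le_five
    omega
  have hdvd (x : G) : orderOf x ∈ Nat.divisors 8 := by
    simpa [hG] using orderOf_dvd_natCard x
  have hdiv : Nat.divisors 8 = {1, 2, 4, 8} := by decide
  have hord (x : G) : x ^ 2 = 1 ∨ orderOf x = 4 := by
    have hx := hdvd x
    simp only [hdiv, Finset.mem_insert, Finset.mem_singleton] at hx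
    rcases hx with hx | hx | hx | hx
    · exact .inl (orderOf_dvd_iff_pow_eq_one.mp (by simp [hx]))
    · exact .inl (orderOf_dvd_iff_pow_eq_one.mp (by simp [hx]))
    · exact .inr hx
    · exact absurd hx (hno8 x)
  obtain ⟨a, ha⟩ : ∃ a : G, orderOf a = 4 := by
    by_contra! hne
    have hle := ncard_le_card_cyclic_subgroups (Set.univ : Set G) fun x _ y _ hxy ↦
      eq_of_zpowers_eq_of_sq_eq_one ((hord x).resolve_right (hne x)) hxy
    rw [Set.ncard_univ] at hle
    omega
  have ha4 : a ^ 4 = 1 := ha ▸ pow_orderOf_eq_one a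
  have hidx : (zpowers a).index = 2 := by
    have := (zpowers a).card_mul_index
    rw [Nat.card_zpowers, ha, hG] at this
    omega
  have hnormal := normal_of_index_eq_two hidx
  obtain ⟨b, hb⟩ : ∃ b, b ∉ zpowers a := by
    by_contra! hall
    rw [(eq_top_iff' _).mpr hall, index_top] at hidx
    omega
  have hb2 : b ^ 2 = 1 ∨ b ^ 2 = a ^ 2 := by
    rcases hord b with hb2 | hb4
    · exact .inl hb2
    · obtain ⟨i, hi, hi'⟩ := exists_pow_eq_of_mem_zpowers ha (x := b ^ 2)
        (by rw [pow_two, mul_mem_iff_of_index_two hidx])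
      have hb4' : (b ^ 2) ^ 2 = 1 := by rw [← pow_mul, ← pow_orderOf_eq_one b, hb4]
      have hne : a ^ 2 ≠ 1 := pow_ne_one_of_lt_orderOf two_ne_zero (by omega)
      rw [← hi'] at hb4' ⊢
      interval_cases i
      · simp
      · exact absurd (by simpa using hb4') hne
      · simp
      · refine absurd ?_ hne
        rwa [← pow_mul, show 3 * 2 = 4 + 2 from rfl, pow_add, ha4, one_mul] at hb4'
  have hcover (x : G) (hx : x ∉ zpowers a) : ∃ i < 4, x = b * a ^ i := by
    obtain ⟨i, hi, hi'⟩ := exists_pow_eq_of_mem_zpowers ha (x := b⁻¹ * x)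
      (by simp [mul_mem_iff_of_index_two hidx, hx, hb])
    exact ⟨i, hi, by rw [hi', mul_inv_cancel_left]⟩
  rcases mul_mul_inv_eq_self_or_inv ha hnormal b with hconj | hconj
  · have hcomm : Commute b a := mul_inv_eq_iff_eq_mul.mp hconj
    rcases hb2 with hb2 | hb2
    · exact nonempty_mulEquiv_of_commute hG ha hb2 hb hcomm
    · refine nonempty_mulEquiv_of_commute hG ha (b := b * a) ?_ ?_ (hcomm.mul_left (.refl a))
      · rw [hcomm.mul_pow, hb2, ← pow_add, ha4]
      · simpa [mul_mem_iff_of_index_two hidx] using hb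
  · have hconj' (i : ℕ) : b * a ^ i = (a ^ i)⁻¹ * b := by
      rw [← mul_inv_eq_iff_eq_mul, ← conj_pow, hconj, inv_pow]
    have hsq (i : ℕ) : (b * a ^ i) ^ 2 = b ^ 2 := by
      rw [pow_two, mul_assoc, ← mul_assoc (a ^ i), mul_assoc (a ^ i), hconj' i,
        mul_inv_cancel_left, pow_two]
    rcases hb2 with hb2 | hb2
    · have hsq_or_eq (x : G) (hx : x ≠ a⁻¹) : x ^ 2 = 1 ∨ x = a := by
        by_cases hxa : x ∈ zpowers a
        · obtain ⟨i, hi, rfl⟩ := exists_pow_eq_of_mem_zpowers ha hxa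
          interval_cases i
          · simp
          · simp
          · exact .inl (by rw [← pow_mul, ha4])
          · exact absurd (eq_inv_of_mul_eq_one_left (by rw [← pow_succ, ha4])) hx
        · obtain ⟨i, -, rfl⟩ := hcover x hxa
          exact .inl (by rw [hsq, hb2])
      have hle := ncard_le_card_cyclic_subgroups ({a⁻¹}ᶜ : Set G) fun x hx y hy hxy ↦ by
        rcases hsq_or_eq x hx with hx2 | rfl
        · exact eq_of_zpowers_eq_of_sq_eq_one hx2 hxy
        · rcases hsq_or_eq y hy with hy2 | rfl
          · exact (eq_of_zpowers_eq_of_sq_eq_one hy2 hxy.symm).symm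
          · rfl
      rw [Set.ncard_compl, Set.ncard_singleton] at hle
      omega
    · have hinv (i : ℕ) : (b * a ^ i)⁻¹ = b * a ^ (i + 2) := by
        refine inv_eq_of_mul_eq_one_right ?_
        rw [pow_add, ← mul_assoc b, ← mul_assoc, ← pow_two, hsq, hb2, ← pow_add, ha4]
      have hle := card_cyclic_subgroups_le {1, a, a ^ 2, b, b * a} (fun x ↦ by
        by_cases hxa : x ∈ zpowers a
        · obtain ⟨i, hi, rfl⟩ := exists_pow_eq_of_mem_zpowers ha hxa
          interval_cases i
          · simp
          · simp
          · simp
          · right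
            rw [inv_eq_of_mul_eq_one_right (b := a) (by rw [← pow_succ, ha4])]
            simp
        · obtain ⟨i, hi, rfl⟩ := hcover x hxa
          interval_cases i
          · simp
          · simp
          · right
            rw [hinv, ha4]
            simp
          · right
            rw [hinv, show 3 + 2 = 4 + 1 from rfl, pow_add, ha4]
            simp)
      have := hle.trans Finset.card_le_five
      omega
end

section
/- Let G be a finite group of order 2^m with m ≥ 5. Then the number of cyclic subgroups of G is not equal to |G| - 2. -/
open scoped Pointwise in
/-- The complement of a proper subgroup contains at least half of the group. -/
theorem Subgroup.card_le_two_mul_ncard_compl {G : Type*} [Group G] [Finite G]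
    (H : Subgroup G) (hH : H ≠ ⊤) : Nat.card G ≤ 2 * ((H : Set G)ᶜ).ncard := by
  obtain ⟨g, hg⟩ : ∃ g, g ∉ H := by
    by_contra! h
    exact hH ((Subgroup.eq_top_iff' H).2 h)
  have hsub : g • (H : Set G) ⊆ (H : Set G)ᶜ := by
    rintro _ ⟨h, hh, rfl⟩ hgh
    exact hg ((H.mul_mem_cancel_right hh).1 hgh)
  have hle := Set.ncard_le_ncard hsub
  rw [Set.ncard_smul_set] at hle
  have := Set.ncard_add_ncard_compl (H : Set G)
  omega

open scoped Pointwise in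
/-- If at most four elements of a finite group of order greater than 16 fail to square to `1`,
then every element squares to `1`. -/
theorem sq_eq_one_of_ncard_sq_ne_one_le {G : Type*} [Group G] [Finite G]
    (hG : 16 < Nat.card G) (hT : {x : G | x ^ 2 ≠ 1}.ncard ≤ 4) (y : G) : y ^ 2 = 1 := by
  set T : Set G := {x : G | x ^ 2 ≠ 1} with hTdef
  have central : ∀ s : G, s ^ 2 = 1 → ∀ t, Commute s t := by
    intro s hs
    have htop : Subgroup.centralizer {s} = ⊤ := by
      by_contra hne
      have hsub : ((Subgroup.centralizer {s} : Subgroup G) : Set G)ᶜ ⊆ T ∪ s⁻¹ • T := by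
        intro t ht
        by_contra hn
        simp only [hTdef, Set.mem_union, Set.mem_smul_set_iff_inv_smul_mem, Set.mem_ofPred_eq,
          inv_inv, smul_eq_mul, not_or, not_not] at hn
        obtain ⟨h1, h2⟩ := hn
        refine ht (Subgroup.mem_centralizer_singleton_iff.2 ?_)
        rw [sq] at hs h1 h2
        have hst := eq_inv_of_mul_eq_one_left h2
        rw [mul_inv_rev, ← eq_inv_of_mul_eq_one_left hs, ← eq_inv_of_mul_eq_one_left h1] at hst
        exact hst.symm
      have h1 := Subgroup.card_le_two_mul_ncard_compl _ hne
      have h2 := Set.ncard_le_ncard hsub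
      have h3 := Set.ncard_union_le T (s⁻¹ • T)
      rw [Set.ncard_smul_set] at h3
      omega
    intro t
    have ht : t ∈ Subgroup.centralizer {s} := htop ▸ Subgroup.mem_top t
    have := Subgroup.mem_centralizer_singleton_iff.1 ht
    exact this.symm
  by_contra hy
  have hsub : y • Tᶜ ⊆ T := by
    rintro _ ⟨s, hs, rfl⟩
    have hs : s ^ 2 = 1 := not_not.1 hs
    change (y * s) ^ 2 ≠ 1
    rwa [(central s hs y).symm.mul_pow, hs, mul_one]
  have h1 := Set.ncard_le_ncard hsub
  rw [Set.ncard_smul_set] at h1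
  have h2 := Set.ncard_add_ncard_compl T
  omega

open scoped Pointwise in
theorem card_cyclic_ne_sub_two_of_large_two_group (G : Type*) [Group G] [Finite G]
    (m : ℕ) (hm : 5 ≤ m) (hG : Nat.card G = 2 ^ m) :
    Nat.card {H : Subgroup G // IsCyclic H} ≠ Nat.card G - 2 := by
  intro hC
  have hcard : 2 ^ 5 ≤ Nat.card G := hG ▸ Nat.pow_le_pow_right two_pos hm
  have hgen : ∀ H : {H : Subgroup G // IsCyclic H}, ∃ g : G, Subgroup.zpowers g = H.1 :=
    fun H => (Subgroup.isCyclic_iff_exists_zpowers_eq_top H.1).1 H.2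
  choose gen hgen using hgen
  have hinj : Function.Injective gen := fun H K h => Subtype.ext (by rw [← hgen, ← hgen, h])
  set R : Set G := Set.range gen with hR
  have hRcard : R.ncard = Nat.card G - 2 := by
    rw [hR, ← Set.image_univ, Set.ncard_image_of_injective _ hinj, Set.ncard_univ, hC]
  have hRc : Rᶜ.ncard = 2 := by
    have := Set.ncard_add_ncard_compl R
    omega
  have hsub : {x : G | x ^ 2 ≠ 1} ⊆ Rᶜ ∪ Rᶜ⁻¹ := by
    intro x hx
    by_contra hn
    simp only [Set.mem_union, Set.mem_inv, Set.mem_compl_iff, not_or, not_not] at hn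
    obtain ⟨⟨H, hH⟩, ⟨K, hK⟩⟩ := hn
    have hHK : H = K := by
      apply Subtype.ext
      rw [← hgen, ← hgen, hH, hK, Subgroup.zpowers_inv]
    rw [← hHK, hH] at hK
    exact hx (by rw [sq, mul_eq_one_iff_eq_inv, ← hK])
  have hT : {x : G | x ^ 2 ≠ 1}.ncard ≤ 4 := by
    have h1 := Set.ncard_le_ncard hsub
    have h2 := Set.ncard_union_le Rᶜ Rᶜ⁻¹
    rw [Set.ncard_inv] at h2
    omega
  have hsq := sq_eq_one_of_ncard_sq_ne_one_le (by omega) hT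
  obtain ⟨y, hy⟩ : Rᶜ.Nonempty := Set.nonempty_of_ncard_ne_zero (by omega)
  apply hy
  refine ⟨⟨Subgroup.zpowers y, inferInstance⟩, ?_⟩
  have hz := hgen ⟨Subgroup.zpowers y, inferInstance⟩
  generalize gen _ = z at hz ⊢
  change Subgroup.zpowers z = Subgroup.zpowers y at hz
  have hmem : z ∈ Subgroup.zpowers y := hz ▸ Subgroup.mem_zpowers z
  obtain ⟨k, rfl⟩ := Subgroup.mem_zpowers_iff.1 hmem
  have hy2 : y ^ (2 : ℤ) = 1 := mod_cast hsq y
  rcases Int.even_or_odd' k with ⟨j, rfl | rfl⟩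
  · rw [zpow_mul, hy2, one_zpow] at hz ⊢
    rw [Subgroup.zpowers_one_eq_bot, eq_comm, Subgroup.zpowers_eq_bot] at hz
    exact hz.symm
  · rw [zpow_add, zpow_mul, hy2, one_zpow, one_mul, zpow_one]
end

section
/- Let G be a finite group of order 16 such that the number of cyclic subgroups of G equals 14. Then G is isomorphic to Z/2Z × D8, where D8 is the dihedral group of order 8. -/
theorem exists_monoidHom_multiplicative_zmod {G : Type*} [Group G] (n : ℕ) (g : G)
    (hg : g ^ n = 1) :
    ∃ f : Multiplicative (ZMod n) →* G, ∀ k : ℤ, f (Multiplicative.ofAdd (k : ZMod n)) = g ^ k := by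
  let z : ℤ →+ Additive G := (zpowersHom G g).toAdditiveRight
  have hz : z n = 0 := by
    change g ^ (n : ℤ) = 1
    simpa using hg
  refine ⟨(ZMod.lift n ⟨z, hz⟩).toMultiplicativeLeft, fun k => ?_⟩
  change (ZMod.lift n ⟨z, hz⟩ (k : ZMod n)).toMul = g ^ k
  rw [ZMod.lift_coe]
  rfl

theorem exists_monoidHom_dihedralGroup {G : Type*} [Group G] (n : ℕ) (r s : G)
    (hr : r ^ n = 1) (hs : s * s = 1) (hsr : s * r * s = r⁻¹) :
    ∃ f : DihedralGroup n →* G, ∀ k : ℤ,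
      f (DihedralGroup.r k) = r ^ k ∧ f (DihedralGroup.sr k) = s * r ^ k := by
  obtain ⟨φ, hφ⟩ := exists_monoidHom_multiplicative_zmod n r hr
  have hs' : s⁻¹ = s := inv_eq_of_mul_eq_one_left hs
  have hconj (k : ℤ) : s * r ^ k * s = r ^ (-k) := by
    have h := conj_zpow (i := k) (a := s) (b := r)
    rw [hs', hsr] at h
    rw [← h, inv_zpow, zpow_neg]
  have hcomm (k : ℤ) : r ^ k * s = s * r ^ (-k) := by
    rw [← hconj, ← mul_assoc, ← mul_assoc, hs, one_mul]
  let F : DihedralGroup n → G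
    | .r i => φ (.ofAdd i)
    | .sr i => s * φ (.ofAdd i)
  have hFr (k : ℤ) : F (.r k) = r ^ k := hφ k
  have hFsr (k : ℤ) : F (.sr k) = s * r ^ k := congrArg (s * ·) (hφ k)
  refine ⟨MonoidHom.mk' F ?_, fun k => ⟨hFr k, hFsr k⟩⟩
  rintro (i | i) (j | j) <;> obtain ⟨i, rfl⟩ := ZMod.intCast_surjective i <;>
    obtain ⟨j, rfl⟩ := ZMod.intCast_surjective j
  · rw [DihedralGroup.r_mul_r, ← Int.cast_add, hFr, hFr, hFr, zpow_add]
  · rw [DihedralGroup.r_mul_sr, ← Int.cast_sub, hFr, hFsr, hFsr, ← mul_assoc, hcomm, mul_assoc,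
      ← zpow_add, neg_add_eq_sub]
  · rw [DihedralGroup.sr_mul_r, ← Int.cast_add, hFr, hFsr, hFsr, zpow_add, mul_assoc]
  · rw [DihedralGroup.sr_mul_sr, ← Int.cast_sub, hFr, hFsr, hFsr, ← mul_assoc, mul_assoc s, hcomm,
      ← mul_assoc, hs, one_mul, ← zpow_add, neg_add_eq_sub]

/-- A group of order 16 containing a dihedral group of order 8 and an involution outside it that
centralizes it is their direct product. -/
theorem nonempty_mulEquiv_zmod_two_prod_dihedralGroup_four {G : Type*} [Group G] [Finite G]
    (hG : Nat.card G = 16) (r s z : G) (hr : r ^ 4 = 1) (hr2 : r ^ 2 ≠ 1) (hs : s * s = 1)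
    (hsr : s * r * s = r⁻¹) (hz : z ^ 2 = 1) (hz1 : z ≠ 1) (hzr2 : z ≠ r ^ 2)
    (hzr : Commute z r) (hzs : Commute z s) :
    Nonempty (G ≃* (Multiplicative (ZMod 2) × DihedralGroup 4)) := by
  obtain ⟨φ, hφ⟩ := exists_monoidHom_multiplicative_zmod 2 z hz
  obtain ⟨ψ, hψ⟩ := exists_monoidHom_dihedralGroup 4 r s hr hs hsr
  have hcomm : ∀ a d, Commute (φ a) (ψ d) := by
    intro a d
    obtain ⟨a, rfl⟩ := Multiplicative.ofAdd.surjective a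
    obtain ⟨a, rfl⟩ := ZMod.intCast_surjective a
    rw [hφ]
    apply Commute.zpow_left
    rcases d with i | i <;> obtain ⟨i, rfl⟩ := ZMod.intCast_surjective i
    · rw [(hψ i).1]; exact hzr.zpow_right i
    · rw [(hψ i).2]; exact hzs.mul_right (hzr.zpow_right i)
  have hncomm : ¬ Commute s r := by
    intro h
    apply hr2
    rw [h.eq, mul_assoc, hs, mul_one] at hsr
    rw [pow_two]
    nth_rewrite 1 [hsr]
    exact inv_mul_cancel r
  let f := φ.noncommCoprod ψ hcomm
  have hinj : Function.Injective f := by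
    rw [injective_iff_map_eq_one]
    rintro ⟨a, d⟩ h
    rw [MonoidHom.noncommCoprod_apply] at h
    obtain ⟨a, rfl⟩ := Multiplicative.ofAdd.surjective a
    rcases d with i | i
    · have hr3 : r ^ 3 = r⁻¹ := by
        rw [eq_inv_iff_mul_eq_one, ← pow_succ, hr]
      have hws : Commute (φ (.ofAdd a)) s := by
        obtain ⟨a, rfl⟩ := ZMod.intCast_surjective a
        rw [hφ]
        exact hzs.zpow_left a
      rw [mul_eq_one_iff_eq_inv] at h
      have ha : a = 0 ∧ φ (.ofAdd a) = 1 ∨ φ (.ofAdd a) = z := by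
        have ha : ∀ a : ZMod 2, a = 0 ∨ a = (1 : ℤ) := by decide
        rcases ha a with rfl | rfl
        · exact Or.inl ⟨rfl, map_one φ⟩
        · exact Or.inr (by rw [hφ, zpow_one])
      have hi : ∀ i : ZMod 4, i = 0 ∨ i = (1 : ℤ) ∨ i = (2 : ℤ) ∨ i = (3 : ℤ) := by decide
      rcases hi i with rfl | rfl | rfl | rfl
      · rw [DihedralGroup.r_zero, map_one, inv_one] at h
        rcases ha with ⟨rfl, -⟩ | ha
        · rfl
        · exact absurd (ha.symm.trans h) hz1
      · rw [(hψ 1).1, zpow_one] at h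
        rw [h] at hws
        exact absurd (by simpa using hws.symm) hncomm
      · have hr2i : (r ^ 2)⁻¹ = r ^ 2 := by
          rw [inv_eq_iff_mul_eq_one, ← pow_add, hr]
        rw [(hψ 2).1, zpow_ofNat, hr2i] at h
        rcases ha with ⟨-, ha⟩ | ha
        · exact absurd (h.symm.trans ha) hr2
        · exact absurd (ha.symm.trans h) hzr2
      · rw [(hψ 3).1, zpow_ofNat, hr3, inv_inv] at h
        rw [h] at hws
        exact absurd hws.symm hncomm
    · exfalso
      obtain ⟨i, rfl⟩ := ZMod.intCast_surjective i
      have hc := hcomm (.ofAdd a) (.r 1)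
      have h1 := (hψ 1).1
      rw [Int.cast_one, zpow_one] at h1
      rw [h1, eq_inv_of_mul_eq_one_left h, (hψ i).2] at hc
      apply hncomm
      have := (hc.inv_left).mul_left (((Commute.refl r).zpow_left i).inv_left)
      simpa using this
  have hbij : Function.Bijective f := by
    rw [Nat.bijective_iff_injective_and_card]
    refine ⟨hinj, ?_⟩
    rw [Nat.card_prod, DihedralGroup.nat_card, hG]
    simp
  exact ⟨(MulEquiv.ofBijective f hbij).symm⟩

/-- Once a generator is chosen for each cyclic subgroup, every element of order greater than two is
unchosen or has an unchosen inverse. -/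
theorem card_sq_ne_one_le {G : Type*} [Group G] [Fintype G] [DecidableEq G] :
    (Finset.univ.filter fun x : G => x ^ 2 ≠ 1).card
      ≤ 2 * (Nat.card G - Nat.card {H : Subgroup G // IsCyclic H}) := by
  classical
  have hgen (H : {H : Subgroup G // IsCyclic H}) : ∃ g : G, Subgroup.zpowers g = H.1 :=
    (Subgroup.isCyclic_iff_exists_zpowers_eq_top H.1).1 H.2
  choose g hg using hgen
  have hginj : Function.Injective g := fun H K h => Subtype.ext (by rw [← hg, ← hg, h])
  let B := (Finset.univ.image g)ᶜ
  have hB : B.card = Nat.card G - Nat.card {H : Subgroup G // IsCyclic H} := by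
    rw [Finset.card_compl, Finset.card_image_of_injective _ hginj, Nat.card_eq_fintype_card,
      Nat.card_eq_fintype_card, Finset.card_univ]
  have hsub : (Finset.univ.filter fun x : G => x ^ 2 ≠ 1) ⊆ B ∪ B.image (·⁻¹) := by
    intro x hx
    by_contra hn
    rw [Finset.mem_union, not_or] at hn
    have hmem (y : G) (hy : y ∉ B) : ∃ H, g H = y := by simpa [B] using hy
    obtain ⟨H, hH⟩ := hmem x hn.1
    obtain ⟨K, hK⟩ := hmem x⁻¹ fun hx' => hn.2 (Finset.mem_image.2 ⟨x⁻¹, hx', inv_inv x⟩)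
    have hHK : H = K := Subtype.ext (by rw [← hg, ← hg, hH, hK, Subgroup.zpowers_inv])
    rw [← hHK, hH] at hK
    simp only [Finset.mem_filter, Finset.mem_univ, true_and] at hx
    exact hx (by rw [pow_two]; nth_rewrite 1 [hK]; exact inv_mul_cancel x)
  have h1 := Finset.card_le_card hsub
  have h2 := Finset.card_union_le B (B.image (·⁻¹))
  have h3 : (B.image (·⁻¹)).card ≤ B.card := Finset.card_image_le
  omega

theorem exists_sq_ne_one_of_card_isCyclic_lt {G : Type*} [Group G] [Finite G]
    (h : Nat.card {H : Subgroup G // IsCyclic H} < Nat.card G) : ∃ x : G, x ^ 2 ≠ 1 := by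
  by_contra! hx
  refine h.not_ge (Nat.card_le_card_of_injective
    (fun x : G => (⟨Subgroup.zpowers x, inferInstance⟩ : {H : Subgroup G // IsCyclic H})) ?_)
  intro x y hxy
  have hxy' : Subgroup.zpowers x = Subgroup.zpowers y := congrArg Subtype.val hxy
  have key : ∀ a b : G, a ∈ Subgroup.zpowers b → a = 1 ∨ a = b := by
    rintro a b ⟨k, rfl⟩
    have hb : b ^ (2 : ℤ) = 1 := by exact_mod_cast hx b
    rcases Int.even_or_odd' k with ⟨m, rfl | rfl⟩
    · left; simp [zpow_mul, hb]
    · right; simp [zpow_add, zpow_mul, hb]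
  rcases key x y (hxy' ▸ Subgroup.mem_zpowers x) with h1 | h1
  · rcases key y x (hxy' ▸ Subgroup.mem_zpowers y) with h2 | h2
    · rw [h1, h2]
    · exact h2.symm
  · exact h1

theorem commute_of_sq_eq_one {G : Type*} [Group G] {x y : G} (hx : x ^ 2 = 1) (hy : y ^ 2 = 1)
    (hxy : (x * y) ^ 2 = 1) : Commute x y := by
  rw [pow_two] at hx hy hxy
  rw [Commute, SemiconjBy, ← mul_left_inj (x * y), hxy, mul_assoc, ← mul_assoc x x, hx, one_mul, hy]

theorem index_centralizer_singleton_le_two {G : Type*} [Group G] [Fintype G] [DecidableEq G]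
    (hN : 4 * (Finset.univ.filter fun x : G => x ^ 2 ≠ 1).card ≤ Nat.card G)
    (t : G) (ht : t ^ 2 = 1) : (Subgroup.centralizer {t}).index ≤ 2 := by
  classical
  set N := Finset.univ.filter fun x : G => x ^ 2 ≠ 1 with hNdef
  have hsub : (Finset.univ : Finset G) ⊆ (Finset.univ.filter (· ∈ Subgroup.centralizer {t})) ∪
      (N ∪ N.image (t⁻¹ * ·)) := by
    intro x _
    by_contra hx
    simp only [Finset.mem_union, Finset.mem_filter, Finset.mem_univ, true_and, hNdef,
      Finset.mem_image, not_or, not_not, not_exists, not_and] at hx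
    obtain ⟨h1, h2, h3⟩ := hx
    apply h1
    rw [Subgroup.mem_centralizer_singleton_iff]
    refine (commute_of_sq_eq_one ht h2 ?_).symm
    by_contra h4
    exact h3 _ h4 (by simp)
  have h1 := Finset.card_le_card hsub
  have h2 := Finset.card_union_le (Finset.univ.filter (· ∈ Subgroup.centralizer {t}))
    (N ∪ N.image (t⁻¹ * ·))
  have h3 := Finset.card_union_le N (N.image (t⁻¹ * ·))
  have h4 : (N.image (t⁻¹ * ·)).card ≤ N.card := Finset.card_image_le
  have h5 : (Finset.univ.filter (· ∈ Subgroup.centralizer {t})).card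
      = Nat.card (Subgroup.centralizer {t}) := by
    rw [Nat.card_eq_fintype_card, Fintype.card_subtype]
  have h6 := (Subgroup.centralizer {t}).card_mul_index
  have h7 : 0 < Nat.card (Subgroup.centralizer {t}) := Nat.card_pos
  rw [Finset.card_univ, ← Nat.card_eq_fintype_card] at h1
  by_contra! h8
  nlinarith

theorem group_of_order_sixteen_with_fourteen_cyclic_subgroups (G : Type*) [Group G] [Finite G]
    (hG : Nat.card G = 16) (h : Nat.card {H : Subgroup G // IsCyclic H} = 14) :
    Nonempty (G ≃* (Multiplicative (ZMod 2) × DihedralGroup 4)) := by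
  classical
  have := Fintype.ofFinite G
  have hN := card_sq_ne_one_le (G := G)
  rw [hG, h] at hN
  obtain ⟨n, hn⟩ := exists_sq_ne_one_of_card_isCyclic_lt (G := G) (by omega)
  set N := Finset.univ.filter fun x : G => x ^ 2 ≠ 1 with hNdef
  have memN (x : G) : x ∈ N ↔ x ^ 2 ≠ 1 := by simp [N]
  obtain ⟨s, hs, t, ht, rfl⟩ : ∃ s : G, s ^ 2 = 1 ∧ ∃ t : G, t ^ 2 = 1 ∧ s * t = n := by
    have h1 := Finset.card_union_le N (N.image (n⁻¹ * ·))
    have h2 : (N.image (n⁻¹ * ·)).card ≤ N.card := Finset.card_image_le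
    obtain ⟨x, hx⟩ : ∃ x, x ∉ N ∪ N.image (n⁻¹ * ·) := by
      by_contra! hall
      have h3 := Finset.card_le_card (fun x _ => hall x : Finset.univ ⊆ N ∪ N.image (n⁻¹ * ·))
      rw [Finset.card_univ, ← Nat.card_eq_fintype_card, hG] at h3
      omega
    simp only [Finset.mem_union, memN, Finset.mem_image, not_or, not_not, not_exists,
      not_and] at hx
    have hx' : x⁻¹ = x := inv_eq_of_mul_eq_one_left (by rw [← pow_two, hx.1])
    refine ⟨n * x, ?_, x, hx.1, ?_⟩
    · by_contra h4
      exact hx.2 _ h4 (by simp)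
    · nth_rewrite 2 [← hx']
      exact mul_inv_cancel_right n x
  have hst : ¬ Commute s t := fun hc => hn (by rw [hc.mul_pow, hs, ht, one_mul])
  have hidx (x y : G) (hx : x ^ 2 = 1) (hxy : ¬ Commute y x) :
      (Subgroup.centralizer {x}).index = 2 := by
    have h1 := index_centralizer_singleton_le_two (G := G)
      (by rw [hG]; exact Nat.mul_le_mul_left 4 hN) x hx
    have h2 : (Subgroup.centralizer {x}).index ≠ 1 := by
      rw [Ne, Subgroup.index_eq_one]
      intro htop
      apply hxy
      have : y ∈ Subgroup.centralizer {x} := htop ▸ Subgroup.mem_top y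
      rwa [Subgroup.mem_centralizer_singleton_iff] at this
    have h3 := (Subgroup.centralizer {x}).index_ne_zero_of_finite
    omega
  have hs2 := hidx s t hs fun hc => hst hc.symm
  have ht2 := hidx t s ht hst
  let K := Subgroup.centralizer {s} ⊓ Subgroup.centralizer {t}
  have memK (x : G) : x ∈ K ↔ Commute x s ∧ Commute x t := by
    simp only [K, Subgroup.mem_inf, Subgroup.mem_centralizer_singleton_iff]
    rfl
  have hKsq (k : G) (hk : k ∈ K) : k ^ 2 = 1 := by
    by_contra hk2
    obtain ⟨hks, hkt⟩ := (memK k).1 hk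
    have hks' : (k * t) ^ 2 = k ^ 2 := by rw [hkt.mul_pow, ht, mul_one]
    have hki' : (k⁻¹ * t) ^ 2 = (k ^ 2)⁻¹ := by
      rw [hkt.inv_left.mul_pow, ht, mul_one, inv_pow]
    have ht1 : t ≠ 1 := by rintro rfl; exact hst (Commute.one_right s)
    have hkk : k ≠ k⁻¹ := fun hk' => hk2 (by rw [pow_two]; nth_rewrite 1 [hk']; simp)
    have htk : t ≠ k ^ 2 := fun htk => hst (by rw [htk]; exact (hks.pow_left 2).symm)
    have htk' : t ≠ k⁻¹ ^ 2 := fun htk => hst (by rw [htk]; exact (hks.inv_left.pow_left 2).symm)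
    have hstc : ∀ x, Commute x t → s * t ≠ x := by
      rintro _ hc rfl
      apply hst
      simpa using hc.mul_left (Commute.refl t).inv_left
    have hsub : ({s * t, k, k⁻¹, k * t, k⁻¹ * t} : Finset G) ⊆ N := by
      intro x hx
      simp only [Finset.mem_insert, Finset.mem_singleton] at hx
      rw [memN]
      rcases hx with rfl | rfl | rfl | rfl | rfl
      · exact hn
      · exact hk2
      · simpa using hk2
      · rwa [hks']
      · rw [hki']; simpa using hk2
    have hcard : ({s * t, k, k⁻¹, k * t, k⁻¹ * t} : Finset G).card = 5 := by
      have e1 : k ≠ k⁻¹ * t := fun e => htk (by rw [eq_inv_mul_iff_mul_eq] at e; rw [pow_two, e])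
      have e2 : k⁻¹ ≠ k * t := fun e => htk' (by
        rw [pow_two]; nth_rewrite 2 [e]; simp)
      have e3 : k * t ≠ k⁻¹ * t := fun e => hkk (mul_right_cancel e)
      have c1 := hstc k hkt
      have c2 := hstc _ hkt.inv_left
      have c3 := hstc _ (hkt.mul_left (Commute.refl t))
      have c4 := hstc _ (hkt.inv_left.mul_left (Commute.refl t))
      rw [Finset.card_insert_of_notMem, Finset.card_insert_of_notMem,
        Finset.card_insert_of_notMem, Finset.card_pair e3]
      · simp only [Finset.mem_insert, Finset.mem_singleton, not_or]
        exact ⟨e2, by simpa using ht1⟩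
      · simp only [Finset.mem_insert, Finset.mem_singleton, not_or]
        exact ⟨hkk, by simpa using ht1, e1⟩
      · simp only [Finset.mem_insert, Finset.mem_singleton, not_or]
        exact ⟨c1, c2, c3, c4⟩
    have := Finset.card_le_card hsub
    omega
  have hr2K : (s * t) ^ 2 ∈ K :=
    ⟨Subgroup.sq_mem_of_index_two hs2 _, Subgroup.sq_mem_of_index_two ht2 _⟩
  have hKcard : 4 ≤ Nat.card K := by
    have h1 : K.index ≤ 4 := by
      have := Subgroup.index_inf_le (H := Subgroup.centralizer {s}) (K := Subgroup.centralizer {t})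
      rwa [hs2, ht2] at this
    have h2 := K.card_mul_index
    rw [hG] at h2
    by_contra! h3
    nlinarith
  obtain ⟨z, hzK, hz1, hzr⟩ : ∃ z ∈ K, z ≠ 1 ∧ z ≠ (s * t) ^ 2 := by
    by_contra! hall
    have hsub : (K : Set G) ⊆ {1, (s * t) ^ 2} := by
      intro x hx
      by_cases hx1 : x = 1
      · exact Or.inl hx1
      · exact Or.inr (hall x hx hx1)
    have h1 := Set.ncard_le_ncard hsub
    have h2 := Set.ncard_insert_le (1 : G) {(s * t) ^ 2}
    rw [Set.ncard_singleton] at h2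
    have h3 : (K : Set G).ncard = Nat.card K := rfl
    omega
  obtain ⟨hzs, hzt⟩ := (memK z).1 hzK
  rw [pow_two] at hs ht
  refine nonempty_mulEquiv_zmod_two_prod_dihedralGroup_four hG (s * t) s z ?_ hn hs ?_
    (hKsq z hzK) hz1 hzr (hzs.mul_right hzt) hzs
  · rw [show 4 = 2 * 2 from rfl, pow_mul]
    exact hKsq _ hr2K
  · rw [← mul_assoc, hs, one_mul, mul_inv_rev, inv_eq_of_mul_eq_one_left hs,
      inv_eq_of_mul_eq_one_left ht]
end

section
/- Let m ≥ 1 and let G = (Z/2Z)^m × Z/3Z. Then the number of cyclic subgroups of G equals |G| - 2 if and only if m = 1. -/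
theorem Subgroup.eq_of_mem_zpowers_of_sq_eq_one {V : Type*} [Group V] (hV : ∀ v : V, v ^ 2 = 1)
    {v w : V} (hv : v ∈ Subgroup.zpowers w) (hw : w ∈ Subgroup.zpowers v) : v = w := by
  obtain ⟨l, rfl⟩ := Subgroup.mem_zpowers_iff.1 hw
  rcases Int.even_or_odd' l with ⟨k, rfl | rfl⟩
  · have h : v ^ (2 * k) = 1 := by
      rw [zpow_mul, zpow_ofNat, hV, one_zpow]
    rw [h] at hv ⊢
    simpa using hv
  · rw [zpow_add_one, zpow_mul, zpow_ofNat, hV, one_zpow, one_mul]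

/-- Every cyclic subgroup of `V × C₃`, with `V` of exponent dividing two, has a unique generator
whose second coordinate is trivial or the standard generator of `C₃`. -/
theorem Subgroup.bijective_zpowers_prod_three {V : Type*} [Group V] (hV : ∀ v : V, v ^ 2 = 1) :
    Function.Bijective (fun p : V × Bool =>
      (⟨Subgroup.zpowers (p.1, if p.2 then Multiplicative.ofAdd (1 : ZMod 3) else 1),
        inferInstance⟩ : {H : Subgroup (V × Multiplicative (ZMod 3)) // IsCyclic H})) := by
  constructor
  · rintro ⟨v, a⟩ ⟨w, b⟩ h
    have h' := Subtype.ext_iff.1 h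
    dsimp only at h'
    obtain ⟨k, hk⟩ := Subgroup.mem_zpowers_iff.1 (h' ▸ Subgroup.mem_zpowers _)
    obtain ⟨l, hl⟩ := Subgroup.mem_zpowers_iff.1 (h'.symm ▸ Subgroup.mem_zpowers _)
    have hvw : v = w := Subgroup.eq_of_mem_zpowers_of_sq_eq_one hV
      (Subgroup.mem_zpowers_iff.2 ⟨k, congrArg Prod.fst hk⟩)
      (Subgroup.mem_zpowers_iff.2 ⟨l, congrArg Prod.fst hl⟩)
    have hne : 1 ≠ Multiplicative.ofAdd (1 : ZMod 3) := by decide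
    have hk2 := congrArg Prod.snd hk
    have hl2 := congrArg Prod.snd hl
    cases a <;> cases b
    · rw [hvw]
    · exact absurd ((one_zpow l).symm.trans hl2) hne
    · exact absurd ((one_zpow k).symm.trans hk2) hne
    · rw [hvw]
  · rintro ⟨H, hH⟩
    obtain ⟨⟨v, t⟩, rfl⟩ := (Subgroup.isCyclic_iff_exists_zpowers_eq_top H).1 hH
    have ht : t = 1 ∨ t = Multiplicative.ofAdd 1 ∨ t⁻¹ = Multiplicative.ofAdd 1 :=
      (by decide : ∀ t : Multiplicative (ZMod 3),
        t = 1 ∨ t = Multiplicative.ofAdd 1 ∨ t⁻¹ = Multiplicative.ofAdd 1) t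
    rcases ht with rfl | rfl | ht
    · exact ⟨(v, false), rfl⟩
    · exact ⟨(v, true), rfl⟩
    · refine ⟨(v, true), Subtype.ext ?_⟩
      have hv : v⁻¹ = v := inv_eq_of_mul_eq_one_left (by rw [← sq, hV])
      change Subgroup.zpowers (v, Multiplicative.ofAdd 1) = Subgroup.zpowers (v, t)
      rw [← Subgroup.zpowers_inv (g := (v, t)), Prod.inv_mk, hv, ht]

theorem card_cyclic_subgroups_elementary_abelian_times_three (m : ℕ) (hm : 1 ≤ m) :
    (Nat.card {H : Subgroup ((Fin m → Multiplicative (ZMod 2)) × Multiplicative (ZMod 3)) //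
        IsCyclic H} =
      Nat.card ((Fin m → Multiplicative (ZMod 2)) × Multiplicative (ZMod 3)) - 2) ↔ m = 1 := by
  have hV (v : Fin m → Multiplicative (ZMod 2)) : v ^ 2 = 1 := by
    funext i
    exact (by decide : ∀ x : Multiplicative (ZMod 2), x ^ 2 = 1) (v i)
  have h2 : Nat.card (Multiplicative (ZMod 2)) = 2 := Nat.card_zmod 2
  have h3 : Nat.card (Multiplicative (ZMod 3)) = 3 := Nat.card_zmod 3
  rw [← Nat.card_eq_of_bijective _ (Subgroup.bijective_zpowers_prod_three hV), Nat.card_prod,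
    Nat.card_prod, Nat.card_fun, h2, h3, Nat.card_eq_fintype_card (α := Bool), Fintype.card_bool,
    Nat.card_fin]
  have hpow : 2 ^ 1 ≤ 2 ^ m := Nat.pow_le_pow_right two_pos hm
  constructor
  · intro h
    exact Nat.pow_right_injective le_rfl (show 2 ^ m = 2 ^ 1 by omega)
  · rintro rfl
    norm_num
end

section
/- Let G be a finite group of order 3·2^m (m ≥ 1) having exactly three Sylow 2-subgroups, and let H be a Sylow 2-subgroup of G. Then the normal core of H in G (the intersection of all conjugates of H) has order 2^{m-1}. -/
theorem normalCore_card_of_three_sylow (G : Type*) [Group G] [Finite G]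
    (m : ℕ) (hm : 1 ≤ m) (hG : Nat.card G = 3 * 2 ^ m)
    (hn2 : Nat.card (Sylow 2 G) = 3) (H : Sylow 2 G) :
    Nat.card (H : Subgroup G).normalCore = 2 ^ (m - 1) := by
  have hcard : Nat.card (H : Subgroup G) = 2 ^ m := by
    rw [H.card_eq_multiplicity, hG, Nat.factorization_mul (by norm_num) (by positivity),
      Nat.Prime.factorization_pow Nat.prime_two, Nat.Prime.factorization Nat.prime_three]
    simp
  have hindex : (H : Subgroup G).index = 3 := by
    have h := (H : Subgroup G).card_mul_index
    rw [hcard, hG, mul_comm 3] at h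
    exact Nat.eq_of_mul_eq_mul_left (by positivity) h
  have hdvd : (H : Subgroup G).normalCore.index ∣ 6 := by
    rw [Subgroup.normalCore_eq_ker, Subgroup.index_ker]
    refine (Subgroup.card_subgroup_dvd_card _).trans ?_
    rw [Nat.card_perm, ← Subgroup.index, hindex]
    rfl
  have hrel := Subgroup.relIndex_mul_index (H : Subgroup G).normalCore_le
  rw [hindex] at hrel
  have hne : (H : Subgroup G).normalCore.relIndex H ≠ 1 := by
    intro h
    have heq := le_antisymm (H : Subgroup G).normalCore_le (Subgroup.relIndex_eq_one.mp h)
    have hnormal : (H : Subgroup G).Normal := heq ▸ (H : Subgroup G).normalCore_normal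
    have := Sylow.unique_of_normal H hnormal
    rw [Nat.card_unique] at hn2
    omega
  have htwo : (H : Subgroup G).normalCore.relIndex H = 2 := by
    have h : (H : Subgroup G).normalCore.relIndex H ∣ 2 := by
      rw [← hrel] at hdvd
      exact Nat.dvd_of_mul_dvd_mul_right (by norm_num : 0 < 3) hdvd
    exact ((Nat.dvd_prime Nat.prime_two).mp h).resolve_left hne
  have h := Subgroup.card_mul_index (H : Subgroup G).normalCore
  rw [← hrel, htwo, hG] at h
  obtain ⟨k, rfl⟩ := Nat.exists_eq_add_of_le' hm
  rw [pow_succ] at h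
  simp only [Nat.add_sub_cancel]
  omega
end

section
/- Let G be a finite group of order 3·2^m (m ≥ 1) having exactly three Sylow 2-subgroups, each of which is elementary abelian (every non-identity element has order 2), and having a unique subgroup of order 3. Then G contains a subgroup isomorphic to (Z/2Z)^{m-1} × Z/3Z. -/
/-- A finite group of order `p ^ n` satisfying `g ^ p = 1` for all `g`, written commutatively,
is isomorphic to `(ℤ/pℤ)ⁿ`. -/
theorem CommGroup.nonempty_mulEquiv_pi_zmod {A : Type*} [CommGroup A] (p n : ℕ)
    [Fact p.Prime] (hpow : ∀ a : A, a ^ p = 1) (hcard : Nat.card A = p ^ n) :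
    Nonempty (A ≃* (Fin n → Multiplicative (ZMod p))) := by
  have hp : p.Prime := Fact.out
  let : Module (ZMod p) (Additive A) := AddCommGroup.zmodModule (n := p) hpow
  have : Finite A := Nat.finite_of_card_ne_zero (hcard ▸ pow_ne_zero n hp.ne_zero)
  have hrank : Module.finrank (ZMod p) (Additive A) = n := by
    have h := Module.natCard_eq_pow_finrank (K := ZMod p) (V := Additive A)
    rw [Nat.card_zmod] at h
    exact (Nat.pow_right_injective hp.two_le (hcard.symm.trans h)).symm
  let e : Additive A ≃+ (Fin n → ZMod p) :=
    (Module.finBasisOfFinrankEq (ZMod p) (Additive A) hrank).equivFun.toAddEquiv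
  exact ⟨{ toFun := fun a i => Multiplicative.ofAdd (e (Additive.ofMul a) i)
           invFun := fun f => (e.symm fun i => (f i).toAdd).toMul
           left_inv := fun a => by simp
           right_inv := fun f => by ext i; simp
           map_mul' := fun a b => by ext i; simp }⟩

/-- A group of order `2 ^ n` in which every element squares to `1` is isomorphic to `(ℤ/2ℤ)ⁿ`. -/
theorem Group.nonempty_mulEquiv_pi_zmod_two {A : Type*} [Group A] (n : ℕ)
    (hsq : ∀ a : A, a ^ 2 = 1) (hcard : Nat.card A = 2 ^ n) :
    Nonempty (A ≃* (Fin n → Multiplicative (ZMod 2))) := by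
  have hinv : ∀ a : A, a⁻¹ = a := fun a => by
    rw [inv_eq_iff_mul_eq_one, ← pow_two, hsq]
  let : CommGroup A :=
    { mul_comm := fun a b => by rw [← hinv (a * b), mul_inv_rev, hinv, hinv] }
  exact CommGroup.nonempty_mulEquiv_pi_zmod 2 n hsq hcard

/-- A subgroup which is the only one of its order is normal. -/
theorem Subgroup.normal_of_forall_card_eq {G : Type*} [Group G] {H : Subgroup G}
    (h : ∀ K : Subgroup G, Nat.card K = Nat.card H → K = H) : H.Normal :=
  have : H.Characteristic := Subgroup.characteristic_iff_map_eq.mpr fun φ =>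
    h _ (Subgroup.card_map_of_injective φ.injective)
  inferInstance

/-- The order of a finite group divides `p - 1` times the order of the centralizer of a normal
subgroup of prime order `p`. -/
theorem Subgroup.card_dvd_card_centralizer_mul {G : Type*} [Group G] [Finite G] {p : ℕ}
    [Fact p.Prime] (H : Subgroup G) [H.Normal] (hH : Nat.card H = p) :
    Nat.card G ∣ Nat.card (centralizer (H : Set G)) * (p - 1) := by
  have : IsCyclic H := isCyclic_of_prime_card hH
  have hker : (MulAut.conjNormal : G →* MulAut H).ker ≤ centralizer (H : Set G) := by
    intro g hg x hx
    have h := congr_arg Subtype.val (DFunLike.congr_fun (MonoidHom.mem_ker.mp hg) ⟨x, hx⟩)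
    rw [MulAut.conjNormal_apply, MulAut.one_apply, mul_inv_eq_iff_eq_mul] at h
    exact h.symm
  have hindex : (MulAut.conjNormal : G →* MulAut H).ker.index ∣ p - 1 := by
    rw [Subgroup.index_ker, ← Nat.totient_prime (Fact.out : p.Prime), ← hH,
      ← IsCyclic.card_mulAut]
    exact Subgroup.card_subgroup_dvd_card _
  rw [← (centralizer (H : Set G)).card_mul_index]
  exact mul_dvd_mul_left _ ((Subgroup.index_dvd_of_le hker).trans hindex)

theorem exists_subgroup_iso_elementary_abelian_times_three (G : Type*) [Group G] [Finite G]
    (m : ℕ) (hm : 1 ≤ m) (hG : Nat.card G = 3 * 2 ^ m)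
    (hn2 : Nat.card (Sylow 2 G) = 3)
    (helem : ∀ P : Sylow 2 G, ∀ g ∈ (P : Subgroup G), g ≠ 1 → orderOf g = 2)
    (h3 : ∃! H : Subgroup G, Nat.card H = 3) :
    ∃ K : Subgroup G,
      Nonempty (K ≃* ((Fin (m - 1) → Multiplicative (ZMod 2)) × Multiplicative (ZMod 3))) := by
  obtain ⟨H, hH, huniq⟩ := h3
  have : H.Normal := Subgroup.normal_of_forall_card_eq fun K hK => huniq K (hK.trans hH)
  have hdvd : 2 ^ (m - 1) ∣ Nat.card (Subgroup.centralizer (H : Set G)) := by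
    have h := H.card_dvd_card_centralizer_mul hH
    rw [hG, ← Nat.sub_add_cancel hm, pow_succ, ← mul_assoc] at h
    exact (Dvd.intro_left 3 rfl).trans (Nat.dvd_of_mul_dvd_mul_right two_pos h)
  obtain ⟨B, hB⟩ := Sylow.exists_subgroup_card_pow_prime 2 hdvd
  let A : Subgroup G := B.map (Subgroup.centralizer (H : Set G)).subtype
  have hA : Nat.card A = 2 ^ (m - 1) :=
    (Subgroup.card_map_of_injective (Subgroup.subtype_injective _)).trans hB
  have hcomm : ∀ (a : A) (h : H), Commute (A.subtype a) (H.subtype h) := by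
    rintro ⟨_, b, -, rfl⟩ h
    exact (b.2 h h.2).symm
  obtain ⟨P, hAP⟩ := (IsPGroup.of_card hA).exists_le_sylow
  have hsq : ∀ a : A, a ^ 2 = 1 := by
    intro a
    by_cases ha : (a : G) = 1
    · rw [OneMemClass.coe_eq_one.mp ha, one_pow]
    · exact Subtype.ext ((helem P a (hAP a.2) ha) ▸ pow_orderOf_eq_one (a : G))
  have hdisj : Disjoint A.subtype.range H.subtype.range := by
    rw [Subgroup.range_subtype, Subgroup.range_subtype]
    refine Subgroup.disjoint_of_coprime_natCard ?_
    rw [hA, hH]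
    exact Nat.Coprime.pow_left _ (by norm_num)
  have hinj : Function.Injective (A.subtype.noncommCoprod H.subtype hcomm) :=
    (MonoidHom.noncommCoprod_injective _ _ _).mpr
      ⟨A.subtype_injective, H.subtype_injective, hdisj⟩
  obtain ⟨e⟩ := Group.nonempty_mulEquiv_pi_zmod_two (m - 1) hsq hA
  let f : H ≃* Multiplicative (ZMod 3) := mulEquivOfPrimeCardEq (p := 3) hH (by simp)
  exact ⟨_, ⟨(MonoidHom.ofInjective hinj).symm.trans (e.prodCongr f)⟩⟩
end

section
/- Let G be a finite group of order 12 such that the number of cyclic subgroups of G equals 10. Then G is isomorphic to the dihedral group D12 of order 12. -/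
/-- The homomorphism out of a dihedral group determined by the images of a rotation and a
reflection. -/
def DihedralGroup.lift {G : Type*} [Group G] {n : ℕ} (r s : G) (hr : r ^ n = 1)
    (hs : s * s = 1) (hsr : s * r * s = r⁻¹) : DihedralGroup n →* G :=
  let φ : ZMod n →+ Additive G :=
    ZMod.lift n ⟨zmultiplesHom (Additive G) (Additive.ofMul r), by
      rw [zmultiplesHom_apply, natCast_zsmul, ← ofMul_pow, hr, ofMul_one]⟩
  MonoidHom.mk' (fun
    | .r i => (φ i).toMul
    | .sr i => s * (φ i).toMul) <| by
    have hφ (i : ZMod n) : (φ i).toMul * s = s * (φ (-i)).toMul := by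
      obtain ⟨k, rfl⟩ := ZMod.intCast_surjective i
      have hs' : s⁻¹ = s := inv_eq_of_mul_eq_one_left hs
      have h : s * r ^ k * s = (r ^ k)⁻¹ := by
        rw [← inv_zpow, ← hsr]
        nth_rewrite 2 4 [← hs']
        rw [conj_zpow]
      rw [map_neg, toMul_neg]
      simp only [φ, ZMod.lift_coe, zmultiplesHom_apply, toMul_zsmul, toMul_ofMul]
      rw [← h, ← mul_assoc, ← mul_assoc, hs, one_mul]
    rintro (i | i) (j | j)
    · simp [DihedralGroup.r_mul_r]
    · simp only [DihedralGroup.r_mul_sr]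
      rw [← mul_assoc, hφ, mul_assoc, ← toMul_add, ← map_add, neg_add_eq_sub]
    · simp [DihedralGroup.sr_mul_r, mul_assoc]
    · simp only [DihedralGroup.sr_mul_sr]
      rw [mul_assoc, ← mul_assoc _ s, hφ, mul_assoc s, ← mul_assoc s s, hs, one_mul,
        ← toMul_add, ← map_add, neg_add_eq_sub]

theorem DihedralGroup.lift_r_intCast {G : Type*} [Group G] {n : ℕ} (r s : G) (hr : r ^ n = 1)
    (hs : s * s = 1) (hsr : s * r * s = r⁻¹) (k : ℤ) :
    DihedralGroup.lift r s hr hs hsr (.r (k : ZMod n)) = r ^ k := by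
  simp [DihedralGroup.lift]

theorem DihedralGroup.lift_sr_intCast {G : Type*} [Group G] {n : ℕ} (r s : G) (hr : r ^ n = 1)
    (hs : s * s = 1) (hsr : s * r * s = r⁻¹) (k : ℤ) :
    DihedralGroup.lift r s hr hs hsr (.sr (k : ZMod n)) = s * r ^ k := by
  simp [DihedralGroup.lift]

theorem DihedralGroup.lift_injective {G : Type*} [Group G] (r s : G)
    (hr : r ^ orderOf r = 1) (hs : s * s = 1) (hsr : s * r * s = r⁻¹) (h2 : r * r ≠ 1) :
    Function.Injective (DihedralGroup.lift r s hr hs hsr) := by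
  rw [injective_iff_map_eq_one]
  rintro (i | i) h
  · obtain ⟨k, rfl⟩ := ZMod.intCast_surjective i
    rw [DihedralGroup.lift_r_intCast, ← orderOf_dvd_iff_zpow_eq_one] at h
    rw [(ZMod.intCast_zmod_eq_zero_iff_dvd _ _).2 h, DihedralGroup.one_def]
  · obtain ⟨k, rfl⟩ := ZMod.intCast_surjective i
    rw [DihedralGroup.lift_sr_intCast] at h
    have hc : Commute s r := by
      rw [eq_inv_of_mul_eq_one_left h]
      exact ((Commute.refl r).zpow_left k).inv_left
    rw [hc.eq, mul_assoc, hs, mul_one] at hsr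
    exact absurd (eq_inv_iff_mul_eq_one.1 hsr) h2

/-- Inversion pairs up the generators of cyclic subgroups, except those squaring to one. -/
theorem two_mul_card_isCyclic_le {G : Type*} [Group G] [Fintype G] [DecidableEq G] :
    2 * Nat.card {H : Subgroup G // IsCyclic H} ≤
      Fintype.card G + (Finset.univ.filter fun g : G => g * g = 1).card := by
  classical
  have hgen (H : {H : Subgroup G // IsCyclic H}) : ∃ g : G, Subgroup.zpowers g = H.1 :=
    (Subgroup.isCyclic_iff_exists_zpowers_eq_top H.1).1 H.2
  choose f hf using hgen
  have hfi : Function.Injective f := fun H K h => by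
    apply Subtype.ext
    rw [← hf H, ← hf K, h]
  have : Fintype {H : Subgroup G // IsCyclic H} := Fintype.ofFinite _
  let A : Finset G := Finset.univ.image f
  let B : Finset G := Finset.univ.image fun H => (f H)⁻¹
  have hA : A.card = Nat.card {H : Subgroup G // IsCyclic H} := by
    rw [Finset.card_image_of_injective _ hfi, Finset.card_univ, Nat.card_eq_fintype_card]
  have hB : B.card = Nat.card {H : Subgroup G // IsCyclic H} := by
    rw [Finset.card_image_of_injective _ fun H K h => hfi (inv_injective h), Finset.card_univ,
      Nat.card_eq_fintype_card]
  have hAB : A ∩ B ⊆ Finset.univ.filter fun g : G => g * g = 1 := by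
    intro g hg
    simp only [A, B, Finset.mem_inter, Finset.mem_image, Finset.mem_univ, true_and] at hg
    obtain ⟨⟨H, rfl⟩, K, hK⟩ := hg
    have hKH : K = H := by
      apply Subtype.ext
      rw [← hf H, ← hf K, ← hK, Subgroup.zpowers_inv]
    subst hKH
    simpa using inv_eq_iff_mul_eq_one.1 hK
  have h1 := Finset.card_union_add_card_inter A B
  have h2 := Finset.card_le_card hAB
  have h3 := Finset.card_le_univ (A ∪ B)
  omega

/-- If many elements square to one, then many of them invert a given element. -/
theorem two_mul_card_le_card_inverting {G : Type*} [Group G] [Fintype G] [DecidableEq G] (c : G) :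
    2 * (Finset.univ.filter fun g : G => g * g = 1).card ≤
      Fintype.card G + (Finset.univ.filter fun g : G => g * g = 1 ∧ g * c * g = c⁻¹).card := by
  set I := Finset.univ.filter fun g : G => g * g = 1 with hI
  have hJ : (I.image (c⁻¹ * ·)).card = I.card :=
    Finset.card_image_of_injective _ (mul_right_injective c⁻¹)
  have hIJ : I ∩ I.image (c⁻¹ * ·) ⊆
      Finset.univ.filter fun g : G => g * g = 1 ∧ g * c * g = c⁻¹ := by
    intro g hg
    simp only [hI, Finset.mem_inter, Finset.mem_image, Finset.mem_filter, Finset.mem_univ,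
      true_and] at hg ⊢
    obtain ⟨hg, x, hx, rfl⟩ := hg
    refine ⟨hg, ?_⟩
    rw [mul_assoc, mul_inv_cancel_left, mul_assoc, hx, mul_one]
  have h1 := Finset.card_union_add_card_inter I (I.image (c⁻¹ * ·))
  have h2 := Finset.card_le_card hIJ
  have h3 := Finset.card_le_univ (I ∪ I.image (c⁻¹ * ·))
  omega

theorem card_inverting_le_card_centralizer {G : Type*} [Group G] [Fintype G] [DecidableEq G]
    (c : G) :
    (Finset.univ.filter fun g : G => g * g = 1 ∧ g * c * g = c⁻¹).card ≤
      Nat.card (Subgroup.centralizer {c}) := by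
  classical
  set S := Finset.univ.filter fun g : G => g * g = 1 ∧ g * c * g = c⁻¹ with hS
  obtain hS0 | ⟨s, hs⟩ := S.eq_empty_or_nonempty
  · simp [hS0]
  simp only [hS, Finset.mem_filter, Finset.mem_univ, true_and] at hs
  rw [← SetLike.coe_sort_coe, Nat.card_coe_set_eq, ← Set.ncard_coe_finset]
  refine Set.ncard_le_ncard_of_injOn (s * ·) ?_ (mul_right_injective s).injOn (Set.toFinite _)
  intro g hg
  simp only [hS, Finset.coe_filter, Finset.mem_univ, true_and, Set.mem_ofPred_eq] at hg
  rw [SetLike.mem_coe, Subgroup.mem_centralizer_singleton_iff]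
  have hgc : g * c = c⁻¹ * g := by
    rw [← hg.2, mul_assoc, hg.1, mul_one]
  have hsc : s * c⁻¹ = c * s := by
    rw [← hs.2, mul_assoc s c s, ← mul_assoc s s, hs.1, one_mul]
  rw [mul_assoc, hgc, ← mul_assoc, hsc, mul_assoc]

theorem group_of_order_twelve_with_ten_cyclic_subgroups (G : Type*) [Group G] [Finite G]
    (hG : Nat.card G = 12) (h : Nat.card {H : Subgroup G // IsCyclic H} = 10) :
    Nonempty (G ≃* DihedralGroup 6) := by
  classical
  have : Fintype G := Fintype.ofFinite G
  have hG' : Fintype.card G = 12 := by rw [← Nat.card_eq_fintype_card, hG]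
  have hI := two_mul_card_isCyclic_le (G := G)
  have : Fact (Nat.Prime 3) := ⟨Nat.prime_three⟩
  obtain ⟨c, hc⟩ := exists_prime_orderOf_dvd_card' (G := G) 3 (by rw [hG]; norm_num)
  have hC : 4 ≤ Nat.card (Subgroup.centralizer {c}) := by
    have h1 := two_mul_card_le_card_inverting c
    have h2 := card_inverting_le_card_centralizer c
    omega
  have hC3 : 3 ∣ Nat.card (Subgroup.centralizer {c}) := by
    rw [← hc]
    exact Subgroup.orderOf_dvd_natCard _ (Subgroup.mem_centralizer_singleton_iff.2 rfl)
  have hC2 : 2 ∣ Nat.card (Subgroup.centralizer {c}) := by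
    have hd := Subgroup.card_subgroup_dvd_card (Subgroup.centralizer {c})
    rw [hG] at hd
    have hle := Nat.le_of_dvd (by norm_num) hd
    generalize Nat.card (Subgroup.centralizer {c}) = m at *
    interval_cases m <;> omega
  obtain ⟨⟨t, htc⟩, ht⟩ := exists_prime_orderOf_dvd_card' 2 hC2
  rw [Subgroup.orderOf_mk] at ht
  have hcomm : Commute c t := (Subgroup.mem_centralizer_singleton_iff.1 htc).symm
  have hr : orderOf (c * t) = 6 := by
    rw [hcomm.orderOf_mul_eq_mul_orderOf_of_coprime (by rw [hc, ht]; norm_num), hc, ht]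
  have hS := two_mul_card_le_card_inverting (c * t)
  obtain ⟨s, hs⟩ : (Finset.univ.filter
      fun g : G => g * g = 1 ∧ g * (c * t) * g = (c * t)⁻¹).Nonempty := by
    rw [← Finset.card_pos]
    omega
  simp only [Finset.mem_filter, Finset.mem_univ, true_and] at hs
  have hr2 : c * t * (c * t) ≠ 1 := by
    rw [← pow_two, Ne, ← orderOf_dvd_iff_pow_eq_one, hr]
    norm_num
  have hinj := DihedralGroup.lift_injective (c * t) s (pow_orderOf_eq_one _) hs.1 hs.2 hr2
  rw [← hr]
  exact ⟨(MulEquiv.ofBijective _ ((Nat.bijective_iff_injective_and_card _).2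
    ⟨hinj, by rw [DihedralGroup.nat_card, hG, hr]⟩)).symm⟩
end
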